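/- arXiv:1205.3632 — 4 statements merged into one kernel-verified Lean document; each statement's English description precedes it below -/
import Mathlib

section
/- Let ℕ_0(x) = {n ∈ ℕ : X_n(x) = 0}. Then for μ_f-a.e. x ∈ [0, 1): liminf_{N→∞} |ℕ_0(x) ∩ {1, …, N}|/N ≥ p_0(α), and p_0(α) > 0. -/
open MeasureTheory Filter Set Matrix

noncomputable def Phi (a b c d z : ℝ) : ℝ := (a * z + b) / (c * z + d)

noncomputable def PhiM (M : Matrix (Fin 2) (Fin 2) ℝ) (z : ℝ) : ℝ :=
  (M 0 0 * z + M 0 1) / (M 1 0 * z + M 1 1)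

noncomputable def entS (p : ℝ) : ℝ := -(p * Real.log p) - (1 - p) * Real.log (1 - p)

noncomputable def Xdig (x : ℝ) (n : ℕ) : ℕ :=
  ⌊(2 : ℝ) ^ n * x⌋₊ - 2 * ⌊(2 : ℝ) ^ (n - 1) * x⌋₊

noncomputable def dyadI (x : ℝ) (n : ℕ) : Set ℝ :=
  Set.Ico ((⌊(2 : ℝ) ^ n * x⌋₊ : ℝ) / 2 ^ n) (((⌊(2 : ℝ) ^ n * x⌋₊ : ℝ) + 1) / 2 ^ n)

noncomputable def matProd (A : ℕ → Matrix (Fin 2) (Fin 2) ℝ) (x : ℝ) (n : ℕ) :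
    Matrix (Fin 2) (Fin 2) ℝ :=
  ((List.range n).map (fun j => A (Xdig x (j + 1)))).prod

noncomputable def Fcal (n : ℕ) : MeasurableSpace ℝ :=
  ⨆ i ∈ Finset.Icc 1 n, MeasurableSpace.comap (fun x : ℝ => Xdig x i) ⊤

noncomputable def Rfun (μf : Measure ℝ) (x : ℝ) (n : ℕ) : ℝ :=
  if n = 0 then 1 else (μf (dyadI x n)).toReal

/-- On every dyadic interval `f` is a Möbius transformation `(p, q, r, s)` of itself. The bound
`α * s ≤ r` on the bottom row controls how the mass of the interval splits into halves. -/
def IsMoebiusOn (f : ℝ → ℝ) (α : ℝ) (n k : ℕ) : Prop :=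
  ∃ p q r s : ℝ, 0 < s ∧ α * s ≤ r ∧ 0 < p * s - q * r ∧
    ∀ u ∈ Set.Icc (0 : ℝ) 1, f ((k + u) / 2 ^ n) = (p * f u + q) / (r * f u + s)

theorem moebius_den_pos {α r s y : ℝ} (hα : -1 < α) (hs : 0 < s) (hr : α * s ≤ r)
    (hy : y ∈ Set.Icc (0 : ℝ) 1) : 0 < r * y + s := by
  obtain ⟨hy0, hy1⟩ := hy
  have h1 : 0 < r + s := by nlinarith
  nlinarith [mul_nonneg hy0 h1.le, mul_nonneg (sub_nonneg.2 hy1) hs.le,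
    mul_nonneg hy0 hs.le]

theorem Phi_comp {p q r s a b c d y : ℝ} (hd : c * y + d ≠ 0) :
    (p * Phi a b c d y + q) / (r * Phi a b c d y + s) =
      ((p * a + q * c) * y + (p * b + q * d)) / ((r * a + s * c) * y + (r * b + s * d)) := by
  have h1 : p * Phi a b c d y + q =
      ((p * a + q * c) * y + (p * b + q * d)) / (c * y + d) := by
    rw [Phi, mul_div_assoc', div_add' _ _ _ hd]; congr 1; ring
  have h2 : r * Phi a b c d y + s =
      ((r * a + s * c) * y + (r * b + s * d)) / (c * y + d) := by
    rw [Phi, mul_div_assoc', div_add' _ _ _ hd]; congr 1; ring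
  rw [h1, h2, div_div_div_cancel_right₀ hd]

theorem IsMoebiusOn.child {f : ℝ → ℝ} {α a b c d : ℝ} {n k : ℕ} (i : ℕ) (hi : i ≤ 1)
    (hf : ∀ u ∈ Set.Icc (0 : ℝ) 1, f u ∈ Set.Icc (0 : ℝ) 1)
    (hdR : ∀ u ∈ Set.Icc (0 : ℝ) 1, f ((i + u) / 2) = Phi a b c d (f u))
    (hden : ∀ y ∈ Set.Icc (0 : ℝ) 1, c * y + d ≠ 0)
    (hdet : 0 < a * d - b * c)
    (hinv : ∀ r s : ℝ, 0 < s → α * s ≤ r →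
      0 < r * b + s * d ∧ α * (r * b + s * d) ≤ r * a + s * c)
    (h : IsMoebiusOn f α n k) : IsMoebiusOn f α (n + 1) (2 * k + i) := by
  obtain ⟨p, q, r, s, hs, hr, hM, hfu⟩ := h
  obtain ⟨hs', hr'⟩ := hinv r s hs hr
  refine ⟨p * a + q * c, p * b + q * d, r * a + s * c, r * b + s * d, hs', hr', ?_, ?_⟩
  · nlinarith [mul_pos hM hdet]
  · intro u hu
    have hi' : (i : ℝ) ≤ 1 := by exact_mod_cast hi
    have hi0 : (0 : ℝ) ≤ i := i.cast_nonneg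
    have hmem : ((i : ℝ) + u) / 2 ∈ Set.Icc (0 : ℝ) 1 :=
      ⟨by linarith [hu.1], by linarith [hu.2]⟩
    have he : (((2 * k + i : ℕ) : ℝ) + u) / 2 ^ (n + 1) = (k + ((i : ℝ) + u) / 2) / 2 ^ n := by
      push_cast; rw [pow_succ]; field_simp; ring
    rw [he, hfu _ hmem, hdR u hu, Phi_comp (hden _ (hf u hu))]

theorem IsMoebiusOn.left_half_ge {f : ℝ → ℝ} {α γ : ℝ} {n k : ℕ} (hα : -1 < α) (hγ : 1 < γ)
    (hf0 : f 0 = 0) (hf1 : f 1 = 1) (hfh : f (1 / 2) = 1 / γ) (h : IsMoebiusOn f α n k) :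
    (α + 1) / (α + γ) * (f ((k + 1) / 2 ^ n) - f (k / 2 ^ n)) ≤
      f ((k + 1 / 2) / 2 ^ n) - f (k / 2 ^ n) := by
  obtain ⟨p, q, r, s, hs, hr, hM, hfu⟩ := h
  have e0 := hfu 0 (by norm_num)
  have e1 := hfu 1 (by norm_num)
  have eh := hfu (1 / 2) (by norm_num)
  rw [hf0, add_zero, mul_zero, mul_zero, zero_add, zero_add] at e0
  rw [hf1, mul_one, mul_one] at e1
  rw [hfh] at eh
  rw [e0, e1, eh]
  have hγ0 : 0 < γ := by linarith
  have h1 : 0 < r + s := by nlinarith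
  have h2 : 0 < r + γ * s := by nlinarith
  have h3 : 0 < α + γ := by linarith
  have hI : (p + q) / (r + s) - q / s = (p * s - q * r) / ((r + s) * s) := by
    field_simp; ring
  have hL : (p * (1 / γ) + q) / (r * (1 / γ) + s) - q / s =
      (r + s) / (r + γ * s) * ((p * s - q * r) / ((r + s) * s)) := by
    have : r * (1 / γ) + s = (r + γ * s) / γ := by field_simp
    rw [this]
    field_simp; ring
  rw [hI, hL]
  refine mul_le_mul_of_nonneg_right ?_ (by positivity)
  rw [div_le_div_iff₀ h3 h2]
  nlinarith [mul_nonneg (sub_nonneg.2 hγ.le) (sub_nonneg.2 hr)]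

theorem isMoebiusOn_dyadic {f : ℝ → ℝ} {α : ℝ} (hα : α ≤ 0)
    (h0 : ∀ n k, IsMoebiusOn f α n k → IsMoebiusOn f α (n + 1) (2 * k))
    (h1 : ∀ n k, IsMoebiusOn f α n k → IsMoebiusOn f α (n + 1) (2 * k + 1)) (n : ℕ) :
    ∀ k < 2 ^ n, IsMoebiusOn f α n k := by
  induction n with
  | zero =>
    intro k hk
    obtain rfl : k = 0 := by simpa using hk
    exact ⟨1, 0, 0, 1, one_pos, by linarith, by norm_num, fun u _ => by simp⟩
  | succ n ih =>
    intro k hk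
    rw [pow_succ] at hk
    obtain ⟨j, rfl | rfl⟩ := k.even_or_odd'
    · exact h0 n j (ih j (by omega))
    · exact h1 n j (ih j (by omega))

/-- The dyadic interval `[k / 2 ^ n, (k + 1) / 2 ^ n)`. -/
def dyadicIco (n k : ℕ) : Set ℝ := Set.Ico ((k : ℝ) / 2 ^ n) (((k : ℝ) + 1) / 2 ^ n)

theorem dyadicIco_split (n k : ℕ) :
    dyadicIco n k = dyadicIco (n + 1) (2 * k) ∪ dyadicIco (n + 1) (2 * k + 1) := by
  have e1 : ((2 * k : ℕ) : ℝ) / 2 ^ (n + 1) = k / 2 ^ n := by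
    push_cast; rw [pow_succ]; field_simp
  have e2 : (((2 * k + 1 : ℕ) : ℝ) + 1) / 2 ^ (n + 1) = (k + 1) / 2 ^ n := by
    push_cast; rw [pow_succ]; field_simp; ring
  have e3 : ((2 * k + 1 : ℕ) : ℝ) = ((2 * k : ℕ) : ℝ) + 1 := by push_cast; ring
  have hle1 : ((2 * k : ℕ) : ℝ) / 2 ^ (n + 1) ≤ (((2 * k : ℕ) : ℝ) + 1) / 2 ^ (n + 1) := by
    gcongr; linarith
  have hle2 : ((2 * k + 1 : ℕ) : ℝ) / 2 ^ (n + 1) ≤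
      (((2 * k + 1 : ℕ) : ℝ) + 1) / 2 ^ (n + 1) := by
    gcongr; linarith
  unfold dyadicIco
  rw [← e1, ← e2]
  rw [e3] at hle2 ⊢
  exact (Set.Ico_union_Ico_eq_Ico hle1 hle2).symm

theorem floor_of_mem_dyadicIco {n k : ℕ} {x : ℝ} (hx : x ∈ dyadicIco n k) :
    ⌊(2 : ℝ) ^ n * x⌋₊ = k := by
  obtain ⟨h1, h2⟩ := hx
  have hp : (0 : ℝ) < 2 ^ n := by positivity
  rw [div_le_iff₀ hp] at h1
  rw [lt_div_iff₀ hp] at h2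
  have hk : (0 : ℝ) ≤ k := k.cast_nonneg
  rw [Nat.floor_eq_iff (by linarith)]
  constructor <;> linarith

theorem Xdig_of_mem_dyadicIco {n k i : ℕ} (hi : i ≤ 1) {x : ℝ}
    (hx : x ∈ dyadicIco (n + 1) (2 * k + i)) : Xdig x (n + 1) = i := by
  have hx' : x ∈ dyadicIco n k := by
    rw [dyadicIco_split]
    interval_cases i
    · exact Or.inl hx
    · exact Or.inr hx
  unfold Xdig
  rw [Nat.add_sub_cancel, floor_of_mem_dyadicIco hx, floor_of_mem_dyadicIco hx']
  omega

theorem measurable_Xdig (n : ℕ) : Measurable fun x : ℝ => Xdig x n := by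
  unfold Xdig
  fun_prop

/-- The weight `t ^ m`, where `m` counts the zeros among the digits `n + 1, …, n + N` of `x`. -/
noncomputable def zeroWeight (t : ENNReal) (n N : ℕ) (x : ℝ) : ENNReal :=
  ∏ j ∈ Finset.range N, if Xdig x (n + j + 1) = 0 then t else 1

theorem measurable_zeroWeight (t : ENNReal) (n N : ℕ) : Measurable (zeroWeight t n N) := by
  unfold zeroWeight
  refine Finset.measurable_fun_prod _ fun j _ => ?_
  exact Measurable.ite (measurable_Xdig _ (measurableSet_singleton 0)) measurable_const
    measurable_const

theorem zeroWeight_succ (t : ENNReal) (n N : ℕ) (x : ℝ) :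
    zeroWeight t n (N + 1) x =
      zeroWeight t (n + 1) N x * if Xdig x (n + 1) = 0 then t else 1 := by
  unfold zeroWeight
  rw [Finset.prod_range_succ']
  congr 1
  refine Finset.prod_congr rfl fun j _ => ?_
  rw [show n + (j + 1) + 1 = n + 1 + j + 1 by ring]

theorem zeroWeight_zero_eq_pow (t : ENNReal) (N : ℕ) (x : ℝ) :
    zeroWeight t 0 N x = t ^ ((Finset.Icc 1 N).filter (fun n => Xdig x n = 0)).card := by
  induction N with
  | zero => simp [zeroWeight]
  | succ N ih =>
    have : zeroWeight t 0 (N + 1) x =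
        zeroWeight t 0 N x * if Xdig x (N + 1) = 0 then t else 1 := by
      simp [zeroWeight, Finset.prod_range_succ]
    rw [this, ih, ← Finset.insert_Icc_right_eq_Icc_add_one (by omega), Finset.filter_insert]
    split_ifs
    · rw [Finset.card_insert_of_notMem (by simp), pow_succ]
    · rw [mul_one]

theorem setLIntegral_zeroWeight_le {μ : Measure ℝ} {t ρ : ENNReal} (ht : t ≠ ⊤)
    (hμ : ∀ n, ∀ k < 2 ^ n, t * μ (dyadicIco (n + 1) (2 * k)) +
      μ (dyadicIco (n + 1) (2 * k + 1)) ≤ ρ * μ (dyadicIco n k)) (N : ℕ) :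
    ∀ n, ∀ k < 2 ^ n, ∫⁻ x in dyadicIco n k, zeroWeight t n N x ∂μ ≤
      ρ ^ N * μ (dyadicIco n k) := by
  induction N with
  | zero => intro n k _; simp [zeroWeight]
  | succ N ih =>
    intro n k hk
    have hk' : 2 * k + 1 < 2 ^ (n + 1) := by rw [pow_succ]; omega
    have hL : ∫⁻ x in dyadicIco (n + 1) (2 * k), zeroWeight t n (N + 1) x ∂μ =
        t * ∫⁻ x in dyadicIco (n + 1) (2 * k), zeroWeight t (n + 1) N x ∂μ := by
      rw [← lintegral_const_mul' _ _ ht]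
      refine setLIntegral_congr_fun measurableSet_Ico fun x hx => ?_
      rw [zeroWeight_succ, if_pos (Xdig_of_mem_dyadicIco (i := 0) (by norm_num) hx), mul_comm]
    have hR : ∫⁻ x in dyadicIco (n + 1) (2 * k + 1), zeroWeight t n (N + 1) x ∂μ =
        ∫⁻ x in dyadicIco (n + 1) (2 * k + 1), zeroWeight t (n + 1) N x ∂μ := by
      refine setLIntegral_congr_fun measurableSet_Ico fun x hx => ?_
      rw [zeroWeight_succ, if_neg (by rw [Xdig_of_mem_dyadicIco le_rfl hx]; norm_num), mul_one]
    calc ∫⁻ x in dyadicIco n k, zeroWeight t n (N + 1) x ∂μ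
        ≤ (∫⁻ x in dyadicIco (n + 1) (2 * k), zeroWeight t n (N + 1) x ∂μ) +
          ∫⁻ x in dyadicIco (n + 1) (2 * k + 1), zeroWeight t n (N + 1) x ∂μ := by
          rw [dyadicIco_split n k]
          exact lintegral_union_le _ _ _
      _ ≤ t * (ρ ^ N * μ (dyadicIco (n + 1) (2 * k))) +
          ρ ^ N * μ (dyadicIco (n + 1) (2 * k + 1)) := by
        rw [hL, hR]
        gcongr
        · exact ih _ _ (by omega)
        · exact ih _ _ hk'
      _ = ρ ^ N * (t * μ (dyadicIco (n + 1) (2 * k)) +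
          μ (dyadicIco (n + 1) (2 * k + 1))) := by ring
      _ ≤ ρ ^ N * (ρ * μ (dyadicIco n k)) := by gcongr; exact hμ n k hk
      _ = ρ ^ (N + 1) * μ (dyadicIco n k) := by ring

theorem exists_exponential_rate {p q : ℝ} (hp0 : 0 < p) (hp1 : p ≤ 1) (hq : q < p) :
    ∃ s > 0, Real.exp (s * q) * (1 - p * (1 - Real.exp (-s))) < 1 := by
  refine ⟨(p - q) / 2, by linarith, ?_⟩
  set s := (p - q) / 2 with hs
  have hs0 : 0 < s := by linarith
  have h1 : 1 - p * (1 - Real.exp (-s)) ≤ Real.exp (-(p * (1 - Real.exp (-s)))) := by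
    linarith [Real.add_one_le_exp (-(p * (1 - Real.exp (-s))))]
  have h2 : s / (1 + s) ≤ 1 - Real.exp (-s) := by
    have h3 : Real.exp (-s) ≤ 1 / (1 + s) := by
      rw [Real.exp_neg, ← one_div]
      exact one_div_le_one_div_of_le (by linarith) (by linarith [Real.add_one_le_exp s])
    have h4 : s / (1 + s) = 1 - 1 / (1 + s) := by field_simp; ring
    linarith
  have h5 : s * q < p * (s / (1 + s)) := by
    rw [← mul_div_assoc, lt_div_iff₀ (by linarith)]
    have : q * (1 + s) < p := by nlinarith
    nlinarith
  calc _ ≤ Real.exp (s * q) * Real.exp (-(p * (1 - Real.exp (-s)))) := by gcongr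
    _ = Real.exp (s * q - p * (1 - Real.exp (-s))) := by rw [← Real.exp_add]; ring_nf
    _ < 1 := by
      rw [Real.exp_lt_one_iff]
      nlinarith [mul_le_mul_of_nonneg_left h2 hp0.le]

/-- If the left half of every dyadic interval carries at least a fraction `p` of its mass, then
almost surely zeros have eventually frequency above any `q < p`. -/
theorem ae_eventually_lt_zero_frequency {μ : Measure ℝ} [IsProbabilityMeasure μ] {p q : ℝ}
    (hp0 : 0 < p) (hp1 : p ≤ 1) (hq : q < p)
    (hμ : ∀ n, ∀ k < 2 ^ n, p * μ.real (dyadicIco n k) ≤ μ.real (dyadicIco (n + 1) (2 * k))) :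
    ∀ᵐ x ∂μ.restrict (Set.Ico 0 1), ∀ᶠ N : ℕ in atTop,
      q * N < ((Finset.Icc 1 N).filter (fun n => Xdig x n = 0)).card := by
  obtain ⟨s, hs, hrate⟩ := exists_exponential_rate hp0 hp1 hq
  have hexp : Real.exp (-s) ≤ 1 := Real.exp_le_one_iff.2 (by linarith)
  have hρ0 : 0 ≤ 1 - p * (1 - Real.exp (-s)) := by nlinarith [Real.exp_pos (-s)]
  set t := ENNReal.ofReal (Real.exp (-s)) with ht
  set ρ := ENNReal.ofReal (1 - p * (1 - Real.exp (-s))) with hρ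
  set w := ENNReal.ofReal (Real.exp (s * q)) with hw
  have hstep : ∀ n, ∀ k < 2 ^ n, t * μ (dyadicIco (n + 1) (2 * k)) +
      μ (dyadicIco (n + 1) (2 * k + 1)) ≤ ρ * μ (dyadicIco n k) := by
    intro n k hk
    have hdisj : Disjoint (dyadicIco (n + 1) (2 * k)) (dyadicIco (n + 1) (2 * k + 1)) := by
      rw [Set.disjoint_left]
      intro x h1 h2
      have := floor_of_mem_dyadicIco h1
      have := floor_of_mem_dyadicIco h2
      omega
    have hadd : μ.real (dyadicIco n k) =
        μ.real (dyadicIco (n + 1) (2 * k)) + μ.real (dyadicIco (n + 1) (2 * k + 1)) := by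
      rw [dyadicIco_split n k, measureReal_union hdisj measurableSet_Ico]
    rw [← ofReal_measureReal (s := dyadicIco (n + 1) (2 * k)),
      ← ofReal_measureReal (s := dyadicIco (n + 1) (2 * k + 1)),
      ← ofReal_measureReal (s := dyadicIco n k), ht, hρ, ← ENNReal.ofReal_mul (by positivity),
      ← ENNReal.ofReal_mul hρ0, ← ENNReal.ofReal_add (by positivity) (by positivity)]
    apply ENNReal.ofReal_le_ofReal
    nlinarith [mul_le_mul_of_nonneg_left (hμ n k hk) (sub_nonneg.2 hexp)]
  have hI : dyadicIco 0 0 = Set.Ico 0 1 := by simp [dyadicIco]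
  have hint (N : ℕ) : ∫⁻ x in Set.Ico 0 1, zeroWeight t 0 N x ∂μ ≤ ρ ^ N := by
    have := setLIntegral_zeroWeight_le ENNReal.ofReal_ne_top hstep N 0 0 (by norm_num)
    rw [hI] at this
    exact this.trans (mul_le_of_le_one_right' prob_le_one)
  have hmarkov (N : ℕ) : μ.restrict (Set.Ico 0 1)
      {x | (((Finset.Icc 1 N).filter (fun n => Xdig x n = 0)).card : ℝ) ≤ q * N} ≤
        (w * ρ) ^ N := by
    calc _ ≤ μ.restrict (Set.Ico 0 1) {x | 1 ≤ w ^ N * zeroWeight t 0 N x} := by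
          refine measure_mono fun x hx => ?_
          simp only [Set.mem_ofPred_eq] at hx ⊢
          rw [zeroWeight_zero_eq_pow, ht, hw, ← ENNReal.ofReal_pow (by positivity),
            ← ENNReal.ofReal_pow (by positivity), ← ENNReal.ofReal_mul (by positivity),
            ENNReal.one_le_ofReal, ← Real.exp_nat_mul, ← Real.exp_nat_mul, ← Real.exp_add,
            Real.one_le_exp_iff]
          nlinarith
      _ ≤ ∫⁻ x in Set.Ico 0 1, w ^ N * zeroWeight t 0 N x ∂μ := by
          have := mul_meas_ge_le_lintegral (μ := μ.restrict (Set.Ico 0 1))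
            ((measurable_zeroWeight t 0 N).const_mul (w ^ N)) 1
          rwa [one_mul] at this
      _ ≤ w ^ N * ρ ^ N := by
          rw [lintegral_const_mul _ (measurable_zeroWeight t 0 N)]
          gcongr
          exact hint N
      _ = (w * ρ) ^ N := (mul_pow _ _ _).symm
  have hlt : w * ρ < 1 := by
    rw [hw, hρ, ← ENNReal.ofReal_mul (by positivity), ENNReal.ofReal_lt_one]
    exact hrate
  have hsum : ∑' N : ℕ, μ.restrict (Set.Ico 0 1)
      {x | (((Finset.Icc 1 N).filter (fun n => Xdig x n = 0)).card : ℝ) ≤ q * N} ≠ ⊤ := by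
    refine ne_top_of_le_ne_top ?_ (ENNReal.tsum_le_tsum hmarkov)
    rw [ENNReal.tsum_geometric]
    exact ENNReal.inv_ne_top.2 (tsub_pos_of_lt hlt).ne'
  filter_upwards [ae_eventually_notMem hsum] with x hx
  filter_upwards [hx] with N hN
  simpa using hN

theorem ae_le_liminf_zero_frequency {μ : Measure ℝ} [IsProbabilityMeasure μ] {p : ℝ}
    (hp0 : 0 < p) (hp1 : p ≤ 1)
    (hμ : ∀ n, ∀ k < 2 ^ n, p * μ.real (dyadicIco n k) ≤ μ.real (dyadicIco (n + 1) (2 * k))) :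
    ∀ᵐ x ∂μ, x ∈ Set.Ico (0 : ℝ) 1 → p ≤ Filter.liminf (fun N : ℕ =>
      (((Finset.Icc 1 N).filter (fun n => Xdig x n = 0)).card : ℝ) / N) Filter.atTop := by
  rw [← ae_restrict_iff' measurableSet_Ico]
  have hall : ∀ᵐ x ∂μ.restrict (Set.Ico 0 1), ∀ j : ℕ, ∀ᶠ N : ℕ in atTop,
      (p - 1 / (j + 1)) * N < ((Finset.Icc 1 N).filter (fun n => Xdig x n = 0)).card :=
    ae_all_iff.2 fun j => ae_eventually_lt_zero_frequency hp0 hp1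
      (sub_lt_self _ Nat.one_div_pos_of_nat) hμ
  filter_upwards [hall] with x hx
  have hbdd : IsBoundedUnder (· ≤ ·) atTop fun N : ℕ =>
      (((Finset.Icc 1 N).filter (fun n => Xdig x n = 0)).card : ℝ) / N := by
    refine isBoundedUnder_of ⟨1, fun N => div_le_one_of_le₀ ?_ N.cast_nonneg⟩
    exact_mod_cast (Finset.card_filter_le _ _).trans (by simp)
  have hj (j : ℕ) : p - 1 / ((j : ℝ) + 1) ≤ Filter.liminf (fun N : ℕ =>
      (((Finset.Icc 1 N).filter (fun n => Xdig x n = 0)).card : ℝ) / N) Filter.atTop := by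
    refine le_liminf_of_le hbdd.isCoboundedUnder_ge ?_
    filter_upwards [hx j, eventually_gt_atTop 0] with N hN hN0
    rw [le_div_iff₀ (by exact_mod_cast hN0)]
    exact hN.le
  refine le_of_tendsto' (x := atTop) (f := fun j : ℕ => p - 1 / ((j : ℝ) + 1)) ?_ hj
  simpa using tendsto_const_nhds.sub (tendsto_one_div_add_atTop_nhds_zero_nat (𝕜 := ℝ))

theorem measureReal_Ico_eq_sub {f : ℝ → ℝ} {μ : Measure ℝ} [IsProbabilityMeasure μ]
    (hfc : ContinuousOn f (Set.Icc 0 1)) (hfm : StrictMonoOn f (Set.Icc 0 1)) (hf0 : f 0 = 0)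
    (hμ : ∀ x ∈ Set.Icc (0 : ℝ) 1, μ (Set.Iic x) = ENNReal.ofReal (f x)) {a b : ℝ}
    (ha : 0 ≤ a) (hab : a ≤ b) (hb : b ≤ 1) : μ.real (Set.Ico a b) = f b - f a := by
  have hnn : ∀ x ∈ Set.Icc (0 : ℝ) 1, 0 ≤ f x := fun x hx =>
    hf0 ▸ hfm.monotoneOn (by norm_num) hx hx.1
  have hIoc : ∀ a b : ℝ, 0 ≤ a → a ≤ b → b ≤ 1 → μ.real (Set.Ioc a b) = f b - f a := by
    intro a b ha hab hb
    have hm : ∀ x ∈ Set.Icc (0 : ℝ) 1, μ.real (Set.Iic x) = f x := fun x hx => by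
      rw [measureReal_def, hμ x hx, ENNReal.toReal_ofReal (hnn x hx)]
    rw [← Set.Iic_sdiff_Iic, measureReal_sdiff (Set.Iic_subset_Iic.2 hab) measurableSet_Iic,
      hm b ⟨ha.trans hab, hb⟩, hm a ⟨ha, hab.trans hb⟩]
  have hatom : ∀ x ∈ Set.Icc (0 : ℝ) 1, μ {x} = 0 := by
    rintro x ⟨hx0, hx1⟩
    rcases hx0.eq_or_lt with rfl | hx0
    · refine measure_mono_null (t := Set.Iic 0) (by simp) ?_
      rw [hμ 0 (by norm_num), hf0, ENNReal.ofReal_zero]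
    · rw [← measureReal_eq_zero_iff]
      refine le_antisymm ?_ measureReal_nonneg
      have hsub : Set.Ico 0 x ⊆ Set.Icc 0 1 := fun y hy => ⟨hy.1, hy.2.le.trans hx1⟩
      have hlim : Tendsto (fun y => f x - f y) (nhdsWithin x (Set.Ico 0 x)) (nhds 0) := by
        have := ((hfc x ⟨hx0.le, hx1⟩).mono hsub).tendsto
        simpa using (tendsto_const_nhds (x := f x)).sub this
      have : (nhdsWithin x (Set.Ico 0 x)).NeBot := by
        rw [← mem_closure_iff_nhdsWithin_neBot, closure_Ico hx0.ne]
        exact ⟨hx0.le, le_rfl⟩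
      refine ge_of_tendsto hlim ?_
      filter_upwards [self_mem_nhdsWithin] with y hy
      rw [← hIoc y x hy.1 hy.2.le hx1]
      exact measureReal_mono (by simpa using hy.2)
  rw [measureReal_congr (Ico_ae_eq_Ioc' (hatom a ⟨ha, hab.trans hb⟩)
    (hatom b ⟨ha.trans hab, hb⟩)), hIoc a b ha hab hb]

theorem IsMoebiusOn.measureReal_left_half_ge {f : ℝ → ℝ} {α γ : ℝ} {n k : ℕ} {μ : Measure ℝ}
    [IsProbabilityMeasure μ] (hα : -1 < α) (hγ : 1 < γ) (hfc : ContinuousOn f (Set.Icc 0 1))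
    (hfm : StrictMonoOn f (Set.Icc 0 1)) (hf0 : f 0 = 0) (hf1 : f 1 = 1)
    (hfh : f (1 / 2) = 1 / γ)
    (hμ : ∀ x ∈ Set.Icc (0 : ℝ) 1, μ (Set.Iic x) = ENNReal.ofReal (f x))
    (hk : k < 2 ^ n) (h : IsMoebiusOn f α n k) :
    (α + 1) / (α + γ) * μ.real (dyadicIco n k) ≤ μ.real (dyadicIco (n + 1) (2 * k)) := by
  have hk1 : (k : ℝ) + 1 ≤ 2 ^ n := by exact_mod_cast hk
  have hpow : (0 : ℝ) < 2 ^ n := by positivity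
  have hbound : ((k : ℝ) + 1) / 2 ^ n ≤ 1 := (div_le_one hpow).2 hk1
  have hI : dyadicIco (n + 1) (2 * k) = Set.Ico ((k : ℝ) / 2 ^ n) ((k + 1 / 2) / 2 ^ n) := by
    unfold dyadicIco
    congr 1 <;> (push_cast; rw [pow_succ]; field_simp)
  rw [hI, dyadicIco,
    measureReal_Ico_eq_sub hfc hfm hf0 hμ (by positivity) (by gcongr; linarith) hbound,
    measureReal_Ico_eq_sub hfc hfm hf0 hμ (by positivity) (by gcongr; norm_num)
      (hbound.trans' (by gcongr; norm_num))]
  exact h.left_half_ge hα hγ hf0 hf1 hfh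

theorem transpose_moebius_ge {α a b c d r s : ℝ} (hb : 0 < b) (hbd : b < d)
    (hfix : a + b = c + d) (hdet : 0 < a * d - b * c) (hα0 : α ≤ 0) (hα1 : -1 < α)
    (hαc : α * b ≤ c) (hs : 0 < s) (hr : α * s ≤ r) :
    0 < r * b + s * d ∧ α * (r * b + s * d) ≤ r * a + s * c := by
  have h1 : 0 ≤ a - α * b := by
    rcases le_or_gt 0 a with h | h
    · have := mul_nonneg (neg_nonneg.2 hα0) hb.le
      linarith
    · by_contra! h'
      have h2 : b * a < b * c := mul_lt_mul_of_pos_left (by linarith) hb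
      have h3 := mul_pos_of_neg_of_neg h (sub_neg.2 hbd)
      linarith
  have h2 : 0 < α * b + d := by
    have := mul_pos (neg_lt_iff_pos_add.1 hα1) hb
    linarith
  have h3 : 0 ≤ (c - α * b) * (α + 1) := mul_nonneg (by linarith) (by linarith)
  constructor
  · linarith [mul_le_mul_of_nonneg_right hr hb.le, mul_pos hs h2]
  · obtain rfl : a = c + d - b := by linarith
    linarith [mul_le_mul_of_nonneg_right hr h1, mul_nonneg hs.le h3]

theorem stmt14
    (a0 b0 c0 d0 a1 b1 c1 d1 : ℝ)
    (hb0 : b0 = 0)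
    (hA1a : 0 < (a0 + b0) / (c0 + d0))
    (hA1b : (a0 + b0) / (c0 + d0) = b1 / d1)
    (hA1c : b1 / d1 < (a1 + b1) / (c1 + d1))
    (hA1d : (a1 + b1) / (c1 + d1) = 1)
    (hA20 : 0 < a0 * d0 - b0 * c0)
    (hA21 : 0 < a1 * d1 - b1 * c1)
    (hA30 : Real.sqrt (a0 * d0 - b0 * c0) < min d0 (c0 + d0))
    (hA31 : Real.sqrt (a1 * d1 - b1 * c1) < min d1 (c1 + d1))
    (f : ℝ → ℝ)
    (hfc : ContinuousOn f (Set.Icc 0 1))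
    (hfm : StrictMonoOn f (Set.Icc 0 1))
    (hf0 : f 0 = 0) (hf1 : f 1 = 1)
    (hdR0 : ∀ x ∈ Set.Icc (0 : ℝ) (1 / 2), f x = Phi a0 b0 c0 d0 (f (2 * x)))
    (hdR1 : ∀ x ∈ Set.Icc (1 / 2 : ℝ) 1, f x = Phi a1 b1 c1 d1 (f (2 * x - 1)))
    (μf : Measure ℝ) [IsProbabilityMeasure μf]
    (hμf : ∀ x ∈ Set.Icc (0 : ℝ) 1, μf (Set.Iic x) = ENNReal.ofReal (f x))
    (γ : ℝ) (hγ : γ = 1 / Phi a0 b0 c0 d0 1)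
    (α : ℝ) (hα : α = min (min 0 (c0 / (d0 - a0))) (c1 / b1))
    :
    0 < (α + 1) / (α + γ) ∧
    ∀ᵐ x ∂μf, x ∈ Set.Ico (0 : ℝ) 1 →
      (α + 1) / (α + γ) ≤
        Filter.liminf (fun N : ℕ =>
          (((Finset.Icc 1 N).filter (fun n => Xdig x n = 0)).card : ℝ) / N)
          Filter.atTop := by
  subst hb0
  simp only [zero_mul, sub_zero, add_zero] at hA1a hA1b hA20 hA30
  obtain ⟨hsd0, hscd0⟩ := lt_min_iff.1 hA30
  obtain ⟨hsd1, hscd1⟩ := lt_min_iff.1 hA31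
  have hd0 : 0 < d0 := (Real.sqrt_nonneg _).trans_lt hsd0
  have hcd0 : 0 < c0 + d0 := (Real.sqrt_nonneg _).trans_lt hscd0
  have hd1 : 0 < d1 := (Real.sqrt_nonneg _).trans_lt hsd1
  have hcd1 : 0 < c1 + d1 := (Real.sqrt_nonneg _).trans_lt hscd1
  rw [Real.sqrt_lt' hd0] at hsd0
  rw [Real.sqrt_lt' hcd1] at hscd1
  have ha0 : 0 < a0 := pos_of_mul_pos_left hA20 hd0.le
  have had0 : a0 < d0 := by nlinarith
  have hb1 : 0 < b1 := by
    rw [hA1b] at hA1a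
    exact (div_pos_iff_of_pos_right hd1).1 hA1a
  have hsum1 : a1 + b1 = c1 + d1 := (div_eq_one_iff_eq hcd1.ne').1 hA1d
  have hlt1 : b1 < d1 := by
    rw [hA1d] at hA1c
    exact (div_lt_one hd1).1 hA1c
  have hacd0 : a0 < c0 + d0 := by
    rw [hA1d, ← hA1b] at hA1c
    exact (div_lt_one hcd0).1 hA1c
  have hcb1 : 0 < c1 + b1 := by nlinarith
  have hα0 : α ≤ 0 := hα ▸ (min_le_left _ _).trans (min_le_left _ _)
  have hαc0 : α * (d0 - a0) ≤ c0 := by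
    rw [← le_div_iff₀ (by linarith)]
    exact hα ▸ (min_le_left _ _).trans (min_le_right _ _)
  have hαc1 : α * b1 ≤ c1 := by
    rw [← le_div_iff₀ hb1]
    exact hα ▸ min_le_right _ _
  have hα1 : -1 < α := by
    rw [hα]
    refine lt_min (lt_min (by norm_num) ?_) ?_
    · rw [lt_div_iff₀ (by linarith)]; linarith
    · rw [lt_div_iff₀ hb1]; linarith
  have hPhi : Phi a0 0 c0 d0 1 = a0 / (c0 + d0) := by simp [Phi]
  have hγ1 : 1 < γ := by
    rw [hγ, hPhi, one_div_div, lt_div_iff₀ ha0]; linarith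
  have hfh : f (1 / 2) = 1 / γ := by
    rw [hdR0 (1 / 2) (by norm_num), show (2 : ℝ) * (1 / 2) = 1 by norm_num, hf1, hγ,
      one_div_one_div]
  have hf : ∀ u ∈ Set.Icc (0 : ℝ) 1, f u ∈ Set.Icc (0 : ℝ) 1 := fun u hu =>
    ⟨hf0 ▸ hfm.monotoneOn (by norm_num) hu hu.1, hf1 ▸ hfm.monotoneOn hu (by norm_num) hu.2⟩
  have hden {c d : ℝ} (hd : 0 < d) (hcd : 0 < c + d) :
      ∀ y ∈ Set.Icc (0 : ℝ) 1, c * y + d ≠ 0 := by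
    rintro y ⟨hy0, hy1⟩
    nlinarith [mul_nonneg hy0 hcd.le, mul_nonneg (sub_nonneg.2 hy1) hd.le]
  have hM := isMoebiusOn_dyadic (f := f) hα0
    (fun n k => IsMoebiusOn.child (a := a0) (b := 0) (c := c0) (d := d0) 0 (by norm_num) hf
      (fun u hu => by
        rw [hdR0 _ ⟨by push_cast; linarith [hu.1], by push_cast; linarith [hu.2]⟩]
        congr 2; push_cast; ring)
      (hden hd0 hcd0) (by linarith) (fun r s hs hr => by
        refine ⟨by nlinarith, ?_⟩
        nlinarith [mul_le_mul_of_nonneg_left hr ha0.le, mul_le_mul_of_nonneg_left hαc0 hs.le]))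
    (fun n k => IsMoebiusOn.child (a := a1) (b := b1) (c := c1) (d := d1) 1 le_rfl hf
      (fun u hu => by
        rw [hdR1 _ ⟨by push_cast; linarith [hu.1], by push_cast; linarith [hu.2]⟩]
        congr 2; push_cast; ring)
      (hden hd1 hcd1) hA21 (fun r s hs hr =>
        transpose_moebius_ge hb1 hlt1 hsum1 hA21 hα0 hα1 hαc1 hs hr))
  have hp0 : 0 < (α + 1) / (α + γ) := div_pos (by linarith) (by linarith)
  refine ⟨hp0, ae_le_liminf_zero_frequency hp0
    ((div_le_one (by linarith)).2 (by linarith)) fun n k hk => 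
    (hM n k hk).measureReal_left_half_ge hα1 hγ1 hfc hfm hf0 hf1 hfh hμf hk⟩
end

section
/- There exists exactly one Borel probability measure ν on [0, 1] satisfying ν(B) = (ν(F_0^{−1}(B)) + ν(F_1^{−1}(B)))/2 for every Borel set B ⊆ [0, 1] (i.e., exactly one μ-stationary measure, where μ is the probability measure assigning mass 1/2 to each of A_0 and A_1 acting on [0,1] by A·z = Φ(A; z)). -/
open MeasureTheory Filter Set Matrix

theorem exists_contraction_eqOn_Phi {a b c d : ℝ} (hdet : 0 < a * d - b * c)
    (hsqrt : Real.sqrt (a * d - b * c) < min d (c + d))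
    (hzero : 0 ≤ b / d) (hone : (a + b) / (c + d) ≤ 1) :
    ∃ K : NNReal, K < 1 ∧ ∃ f : ℝ → ℝ, LipschitzWith K f ∧
      (∀ x, f x ∈ Icc (0 : ℝ) 1) ∧ EqOn f (Phi a b c d) (Icc 0 1) := by
  set m := min d (c + d) with hm
  have hmpos : 0 < m := (Real.sqrt_nonneg _).trans_lt hsqrt
  have hmd : m ≤ d := min_le_left _ _
  have hmcd : m ≤ c + d := min_le_right _ _
  have hden : ∀ x ∈ Icc (0 : ℝ) 1, m ≤ c * x + d := by
    rintro x ⟨hx0, hx1⟩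
    nlinarith [mul_nonneg hx0 (sub_nonneg.2 hmcd), mul_nonneg (sub_nonneg.2 hx1) (sub_nonneg.2 hmd)]
  have hlt : a * d - b * c < m ^ 2 := (Real.sqrt_lt' hmpos).1 hsqrt
  have hmaps : ∀ x ∈ Icc (0 : ℝ) 1, Phi a b c d x ∈ Icc (0 : ℝ) 1 := by
    intro x hx
    have hpos : 0 < c * x + d := hmpos.trans_le (hden x hx)
    refine ⟨hzero.trans ?_, le_trans ?_ hone⟩
    · rw [Phi, div_le_div_iff₀ (by linarith) hpos]
      nlinarith [mul_nonneg hx.1 hdet.le]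
    · rw [Phi, div_le_div_iff₀ hpos (by linarith)]
      nlinarith [mul_nonneg (sub_nonneg.2 hx.2) hdet.le]
  have hlip : LipschitzOnWith (Real.toNNReal ((a * d - b * c) / m ^ 2)) (Phi a b c d)
      (Icc 0 1) := by
    refine LipschitzOnWith.of_dist_le_mul fun x hx y hy => ?_
    have hdx := hden x hx
    have hdy := hden y hy
    have hpx : 0 < c * x + d := hmpos.trans_le hdx
    have hpy : 0 < c * y + d := hmpos.trans_le hdy
    have hdiff : Phi a b c d x - Phi a b c d y
        = (a * d - b * c) / ((c * x + d) * (c * y + d)) * (x - y) := by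
      rw [Phi, Phi, div_sub_div _ _ hpx.ne' hpy.ne', div_mul_eq_mul_div]
      congr 1
      ring
    rw [Real.coe_toNNReal _ (by positivity), Real.dist_eq, Real.dist_eq, hdiff, abs_mul,
      abs_of_pos (by positivity), sq]
    gcongr
  refine ⟨Real.toNNReal ((a * d - b * c) / m ^ 2), ?_,
    IccExtend zero_le_one ((Icc (0 : ℝ) 1).domRestrict (Phi a b c d)), ?_, ?_, ?_⟩
  · rw [Real.toNNReal_lt_one, div_lt_one (by positivity)]
    exact hlt
  · rw [← mul_one (Real.toNNReal _)]
    exact hlip.to_restrict.comp (LipschitzWith.projIcc zero_le_one)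
  · exact fun x => hmaps _ (projIcc (0 : ℝ) 1 zero_le_one x).2
  · intro x hx
    rw [IccExtend_of_mem _ _ hx, domRestrict_apply]

theorem norm_integral_sub_integral_le_of_stationary {f₀ f₁ : ℝ → ℝ} {K : NNReal}
    (h₀ : LipschitzWith K f₀) (h₁ : LipschitzWith K f₁) {μ ν : Measure ℝ}
    [IsProbabilityMeasure μ] [IsProbabilityMeasure ν]
    (hμI : ∀ᵐ x ∂μ, x ∈ Icc (0 : ℝ) 1) (hνI : ∀ᵐ x ∂ν, x ∈ Icc (0 : ℝ) 1)
    (hμ : μ = (2⁻¹ : NNReal) • (μ.map f₀ + μ.map f₁))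
    (hν : ν = (2⁻¹ : NNReal) • (ν.map f₀ + ν.map f₁)) (n : ℕ) :
    ∀ (L : NNReal) (g : ℝ → ℂ), LipschitzWith L g → (∀ x, ‖g x‖ ≤ 1) →
      ‖∫ x, g x ∂μ - ∫ x, g x ∂ν‖ ≤ 2 * (K ^ n * L) := by
  have hint : ∀ (ρ : Measure ℝ) [IsFiniteMeasure ρ] (g : ℝ → ℂ), Continuous g →
      (∀ x, ‖g x‖ ≤ 1) → Integrable g ρ := fun ρ _ g hg hb =>
    Integrable.of_bound hg.aestronglyMeasurable 1 (ae_of_all _ hb)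
  induction n with
  | zero =>
    intro L g hg hb
    have key : ∀ (ρ : Measure ℝ) [IsProbabilityMeasure ρ], (∀ᵐ x ∂ρ, x ∈ Icc (0 : ℝ) 1) →
        ‖∫ x, g x ∂ρ - g 0‖ ≤ L := by
      intro ρ _ hρ
      have h : ‖∫ x, (g x - g 0) ∂ρ‖ ≤ L * ρ.real univ := by
        refine norm_integral_le_of_norm_le_const ?_
        filter_upwards [hρ] with x hx
        refine (hg.norm_sub_le x 0).trans ?_
        rw [sub_zero, Real.norm_eq_abs, abs_of_nonneg hx.1]
        exact mul_le_of_le_one_right L.2 hx.2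
      rw [integral_sub (hint ρ g hg.continuous hb) (integrable_const _)] at h
      simpa using h
    calc ‖∫ x, g x ∂μ - ∫ x, g x ∂ν‖
        = ‖(∫ x, g x ∂μ - g 0) - (∫ x, g x ∂ν - g 0)‖ := by congr 1; ring
      _ ≤ L + L := (norm_sub_le _ _).trans (add_le_add (key μ hμI) (key ν hνI))
      _ = 2 * ((K : ℝ) ^ 0 * L) := by ring
  | succ n ih =>
    intro L g hg hb
    have key : ∀ (ρ : Measure ℝ) [IsProbabilityMeasure ρ],
        ρ = (2⁻¹ : NNReal) • (ρ.map f₀ + ρ.map f₁) →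
        ∫ x, g x ∂ρ = 2⁻¹ * (∫ x, g (f₀ x) ∂ρ + ∫ x, g (f₁ x) ∂ρ) := by
      intro ρ _ hρ
      conv_lhs => rw [hρ]
      rw [integral_smul_nnreal_measure, integral_add_measure
        (hint _ g hg.continuous hb) (hint _ g hg.continuous hb),
        integral_map h₀.continuous.aemeasurable hg.continuous.aestronglyMeasurable,
        integral_map h₁.continuous.aemeasurable hg.continuous.aestronglyMeasurable,
        NNReal.smul_def, Complex.real_smul]
      norm_num
    have e₀ := ih (L * K) (g ∘ f₀) (hg.comp h₀) fun x => hb _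
    have e₁ := ih (L * K) (g ∘ f₁) (hg.comp h₁) fun x => hb _
    simp only [Function.comp_apply, NNReal.coe_mul] at e₀ e₁
    rw [key μ hμ, key ν hν]
    calc _ = ‖(2⁻¹ : ℂ) * ((∫ x, g (f₀ x) ∂μ - ∫ x, g (f₀ x) ∂ν)
            + (∫ x, g (f₁ x) ∂μ - ∫ x, g (f₁ x) ∂ν))‖ := by congr 1; ring
      _ ≤ 2⁻¹ * (2 * (K ^ n * (L * K)) + 2 * (K ^ n * (L * K))) := by
          rw [norm_mul, norm_inv, Complex.norm_ofNat]
          gcongr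
          exact (norm_add_le _ _).trans (add_le_add e₀ e₁)
      _ = _ := by ring

theorem lipschitzWith_cexp_mul_I (t : ℝ) :
    LipschitzWith (Real.toNNReal |t|) fun x : ℝ => Complex.exp (t * x * Complex.I) := by
  refine LipschitzWith.of_dist_le_mul fun x y => ?_
  have h : Complex.exp (t * x * Complex.I) - Complex.exp (t * y * Complex.I)
      = Complex.exp ((t * y : ℝ) * Complex.I) *
        (Complex.exp (Complex.I * (t * (x - y) : ℝ)) - 1) := by
    rw [mul_sub, ← Complex.exp_add, mul_one]
    push_cast
    ring_nf
  rw [dist_eq_norm, h, norm_mul, Complex.norm_exp_ofReal_mul_I, one_mul,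
    Real.coe_toNNReal _ (abs_nonneg t), Real.dist_eq, ← abs_mul]
  exact Real.norm_exp_I_mul_ofReal_sub_one_le

theorem eq_of_stationary {f₀ f₁ : ℝ → ℝ} {K : NNReal} (hK : K < 1)
    (h₀ : LipschitzWith K f₀) (h₁ : LipschitzWith K f₁) {μ ν : Measure ℝ}
    [IsProbabilityMeasure μ] [IsProbabilityMeasure ν]
    (hμI : ∀ᵐ x ∂μ, x ∈ Icc (0 : ℝ) 1) (hνI : ∀ᵐ x ∂ν, x ∈ Icc (0 : ℝ) 1)
    (hμ : μ = (2⁻¹ : NNReal) • (μ.map f₀ + μ.map f₁))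
    (hν : ν = (2⁻¹ : NNReal) • (ν.map f₀ + ν.map f₁)) : μ = ν := by
  refine Measure.ext_of_charFun (funext fun t => ?_)
  rw [charFun_apply_real, charFun_apply_real, ← sub_eq_zero, ← norm_le_zero_iff]
  have hlim : Tendsto (fun n : ℕ => 2 * ((K : ℝ) ^ n * (Real.toNNReal |t| : ℝ))) atTop
      (nhds (2 * (0 * (Real.toNNReal |t| : ℝ)))) :=
    ((tendsto_pow_atTop_nhds_zero_of_lt_one K.2 hK).mul_const _).const_mul _
  rw [zero_mul, mul_zero] at hlim
  refine ge_of_tendsto' hlim fun n => ?_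
  refine norm_integral_sub_integral_le_of_stationary h₀ h₁ hμI hνI hμ hν n _ _
    (lipschitzWith_cexp_mul_I t) fun x => ?_
  rw [← Complex.ofReal_mul, Complex.norm_exp_ofReal_mul_I]

open Classical in
/-- Iterates of de Rham's functional equation `G (x / 2) = f₀ (G x)`,
`G ((x + 1) / 2) = f₁ (G x)`, starting from zero. -/
noncomputable def deRhamIter (f₀ f₁ : ℝ → ℝ) : ℕ → ℝ → ℝ
  | 0 => fun _ => 0
  | n + 1 => fun x =>
      if x < 1 / 2 then f₀ (deRhamIter f₀ f₁ n (2 * x)) else f₁ (deRhamIter f₀ f₁ n (2 * x - 1))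

theorem exists_measurable_deRham {f₀ f₁ : ℝ → ℝ} {K : NNReal} (hK : K < 1)
    (h₀ : LipschitzWith K f₀) (h₁ : LipschitzWith K f₁)
    (m₀ : ∀ x, f₀ x ∈ Icc (0 : ℝ) 1) (m₁ : ∀ x, f₁ x ∈ Icc (0 : ℝ) 1) :
    ∃ G : ℝ → ℝ, Measurable G ∧ (∀ x, G x ∈ Icc (0 : ℝ) 1) ∧
      (∀ x < 1 / 2, G x = f₀ (G (2 * x))) ∧ (∀ x, 1 / 2 ≤ x → G x = f₁ (G (2 * x - 1))) := by
  have hmem : ∀ n x, deRhamIter f₀ f₁ n x ∈ Icc (0 : ℝ) 1 := by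
    rintro (_ | n) x
    · simp [deRhamIter]
    · rw [deRhamIter]
      dsimp only
      split_ifs
      exacts [m₀ _, m₁ _]
  have hdist : ∀ n x, dist (deRhamIter f₀ f₁ n x) (deRhamIter f₀ f₁ (n + 1) x)
      ≤ 1 * (K : ℝ) ^ n := by
    intro n
    induction n with
    | zero =>
      intro x
      simpa using Real.dist_le_of_mem_Icc_01 (hmem 0 x) (hmem 1 x)
    | succ n ih =>
      intro x
      rw [deRhamIter, deRhamIter]
      dsimp only
      rw [pow_succ', mul_left_comm]
      split_ifs
      · exact (h₀.dist_le_mul _ _).trans (mul_le_mul_of_nonneg_left (ih _) K.2)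
      · exact (h₁.dist_le_mul _ _).trans (mul_le_mul_of_nonneg_left (ih _) K.2)
  have hlim : ∀ x, ∃ y, Tendsto (fun n => deRhamIter f₀ f₁ n x) atTop (nhds y) := fun x =>
    cauchySeq_tendsto_of_complete (cauchySeq_of_le_geometric _ 1 hK fun n => hdist n x)
  choose G hG using hlim
  have hmeas : ∀ n, Measurable (deRhamIter f₀ f₁ n) := by
    intro n
    induction n with
    | zero => exact measurable_const
    | succ n ih =>
      refine Measurable.ite measurableSet_Iio ?_ ?_
      · exact h₀.continuous.measurable.comp (ih.comp (by fun_prop))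
      · exact h₁.continuous.measurable.comp (ih.comp (by fun_prop))
  refine ⟨G, measurable_of_tendsto_metrizable hmeas (tendsto_pi_nhds.2 hG),
    fun x => isClosed_Icc.mem_of_tendsto (hG x) (Eventually.of_forall fun n => hmem n x),
    fun x hx => ?_, fun x hx => ?_⟩
  · refine tendsto_nhds_unique ((hG x).comp (tendsto_add_atTop_nat 1)) ?_
    refine ((h₀.continuous.tendsto _).comp (hG (2 * x))).congr fun n => ?_
    simp only [Function.comp_apply, deRhamIter, if_pos hx]
  · refine tendsto_nhds_unique ((hG x).comp (tendsto_add_atTop_nat 1)) ?_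
    refine ((h₁.continuous.tendsto _).comp (hG (2 * x - 1))).congr fun n => ?_
    simp only [Function.comp_apply, deRhamIter, if_neg (not_lt.2 hx)]

theorem exists_stationary {f₀ f₁ : ℝ → ℝ} {K : NNReal} (hK : K < 1)
    (h₀ : LipschitzWith K f₀) (h₁ : LipschitzWith K f₁)
    (m₀ : ∀ x, f₀ x ∈ Icc (0 : ℝ) 1) (m₁ : ∀ x, f₁ x ∈ Icc (0 : ℝ) 1) :
    ∃ ν : Measure ℝ, IsProbabilityMeasure ν ∧ ν (Icc 0 1) = 1 ∧
      ∀ B, MeasurableSet B → ν B = (ν (f₀ ⁻¹' B) + ν (f₁ ⁻¹' B)) / 2 := by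
  obtain ⟨G, hG, hGI, hG₀, hG₁⟩ := exists_measurable_deRham hK h₀ h₁ m₀ m₁
  have hmap : ∀ B, MeasurableSet B →
      (volume.restrict (Ico (0 : ℝ) 1)).map G B = volume (G ⁻¹' B ∩ Ico 0 1) := fun B hB => by
    rw [Measure.map_apply hG hB, Measure.restrict_apply (hG hB)]
  have hdouble : ∀ s : Set ℝ, volume ((fun x => 2 * x) ⁻¹' s) = volume s / 2 := fun s => by
    rw [Real.volume_preimage_mul_left two_ne_zero, mul_comm, abs_of_pos (by norm_num),
      ENNReal.ofReal_inv_of_pos two_pos, ENNReal.ofReal_ofNat, ENNReal.div_eq_inv_mul, mul_comm]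
  have hdouble' : ∀ s : Set ℝ, volume ((fun x => 2 * x - 1) ⁻¹' s) = volume s / 2 := fun s => by
    simp only [sub_eq_add_neg]
    rw [← measure_preimage_add_right volume (-1) s, ← hdouble, ← preimage_comp]
    rfl
  have hone : (volume.restrict (Ico (0 : ℝ) 1)).map G (Icc 0 1) = 1 := by
    rw [hmap _ measurableSet_Icc, eq_univ_of_forall (s := G ⁻¹' Icc 0 1) hGI]
    simp
  refine ⟨(volume.restrict (Ico 0 1)).map G, ⟨?_⟩, hone, fun B hB => ?_⟩
  · rw [hmap _ MeasurableSet.univ]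
    simp
  · rw [hmap _ hB, hmap _ (h₀.continuous.measurable hB), hmap _ (h₁.continuous.measurable hB),
      ENNReal.add_div, ← hdouble, ← hdouble',
      ← measure_inter_add_sdiff (G ⁻¹' B ∩ Ico 0 1) (measurableSet_Iio (a := (1 / 2 : ℝ)))]
    congr 2
    · ext x
      simp only [mem_inter_iff, mem_preimage, mem_Ico, mem_Iio]
      constructor
      · rintro ⟨⟨hB, hx⟩, h⟩
        rw [hG₀ x h] at hB
        exact ⟨hB, by linarith, by linarith⟩
      · rintro ⟨hB, hx⟩
        have h : x < 1 / 2 := by linarith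
        rw [← hG₀ x h] at hB
        exact ⟨⟨hB, by linarith, by linarith⟩, h⟩
    · ext x
      simp only [mem_inter_iff, Set.mem_sdiff, mem_preimage, mem_Ico, mem_Iio, not_lt]
      constructor
      · rintro ⟨⟨hB, hx⟩, h⟩
        rw [hG₁ x h] at hB
        exact ⟨hB, by linarith, by linarith⟩
      · rintro ⟨hB, hx⟩
        have h : 1 / 2 ≤ x := by linarith
        rw [← hG₁ x h] at hB
        exact ⟨⟨hB, by linarith, by linarith⟩, h⟩

theorem existsUnique_stationary {f₀ f₁ : ℝ → ℝ} {K : NNReal} (hK : K < 1)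
    (h₀ : LipschitzWith K f₀) (h₁ : LipschitzWith K f₁)
    (m₀ : ∀ x, f₀ x ∈ Icc (0 : ℝ) 1) (m₁ : ∀ x, f₁ x ∈ Icc (0 : ℝ) 1) :
    ∃! ν : Measure ℝ, IsProbabilityMeasure ν ∧ ν (Icc 0 1) = 1 ∧
      ∀ B, MeasurableSet B → ν B = (ν (f₀ ⁻¹' B) + ν (f₁ ⁻¹' B)) / 2 := by
  have hsmul : ∀ ν : Measure ℝ,
      (∀ B, MeasurableSet B → ν B = (ν (f₀ ⁻¹' B) + ν (f₁ ⁻¹' B)) / 2) →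
      ν = (2⁻¹ : NNReal) • (ν.map f₀ + ν.map f₁) := by
    intro ν hν
    ext B hB
    rw [Measure.smul_apply, Measure.add_apply, Measure.map_apply h₀.continuous.measurable hB,
      Measure.map_apply h₁.continuous.measurable hB, hν B hB, ENNReal.smul_def, smul_eq_mul,
      ENNReal.coe_inv two_ne_zero, ENNReal.coe_ofNat, ENNReal.div_eq_inv_mul]
  have hae : ∀ ν : Measure ℝ, IsProbabilityMeasure ν → ν (Icc 0 1) = 1 →
      ∀ᵐ x ∂ν, x ∈ Icc (0 : ℝ) 1 := fun ν _ h =>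
    (prob_compl_eq_zero_iff measurableSet_Icc).2 h
  obtain ⟨ν, hp, hI, hν⟩ := exists_stationary hK h₀ h₁ m₀ m₁
  refine ⟨ν, ⟨hp, hI, hν⟩, ?_⟩
  rintro μ ⟨hp', hI', hμ⟩
  exact eq_of_stationary hK h₀ h₁ (hae μ hp' hI') (hae ν hp hI) (hsmul μ hμ) (hsmul ν hν)

theorem stmt17
    (a0 b0 c0 d0 a1 b1 c1 d1 : ℝ)
    (hb0 : b0 = 0)
    (hA1a : 0 < (a0 + b0) / (c0 + d0))
    (hA1b : (a0 + b0) / (c0 + d0) = b1 / d1)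
    (hA1c : b1 / d1 < (a1 + b1) / (c1 + d1))
    (hA1d : (a1 + b1) / (c1 + d1) = 1)
    (hA20 : 0 < a0 * d0 - b0 * c0)
    (hA21 : 0 < a1 * d1 - b1 * c1)
    (hA30 : Real.sqrt (a0 * d0 - b0 * c0) < min d0 (c0 + d0))
    (hA31 : Real.sqrt (a1 * d1 - b1 * c1) < min d1 (c1 + d1))
    :
    ∃! ν : Measure ℝ, IsProbabilityMeasure ν ∧ ν (Set.Icc 0 1) = 1 ∧
      ∀ B : Set ℝ, MeasurableSet B →
        ν B = (ν (Phi a0 b0 c0 d0 ⁻¹' B ∩ Set.Icc 0 1) +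
               ν (Phi a1 b1 c1 d1 ⁻¹' B ∩ Set.Icc 0 1)) / 2 := by
  obtain ⟨K₀, hK₀, f₀, h₀, m₀, e₀⟩ := exists_contraction_eqOn_Phi hA20 hA30
    (by simp [hb0]) (by linarith)
  obtain ⟨K₁, hK₁, f₁, h₁, m₁, e₁⟩ := exists_contraction_eqOn_Phi hA21 hA31
    (by linarith) hA1d.le
  have hpre : ∀ (ν : Measure ℝ) (f F : ℝ → ℝ) (B : Set ℝ), IsProbabilityMeasure ν →
      ν (Icc 0 1) = 1 → EqOn f F (Icc 0 1) → ν (F ⁻¹' B ∩ Icc 0 1) = ν (f ⁻¹' B) := by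
    intro ν f F B _ hI he
    rw [inter_comm, ← he.inter_preimage_eq, inter_comm]
    exact measure_inter_conull ((prob_compl_eq_zero_iff measurableSet_Icc).2 hI)
  refine (existsUnique_congr fun ν => ?_).1 (existsUnique_stationary (max_lt hK₀ hK₁)
    (h₀.weaken (le_max_left _ _)) (h₁.weaken (le_max_right _ _)) m₀ m₁)
  refine and_congr_right fun hp => and_congr_right fun hI => forall₂_congr fun B _ => ?_
  rw [hpre ν f₀ _ B hp hI e₀, hpre ν f₁ _ B hp hI e₁]
end

section
/- Let g : [0, 1] → [0, 1] be the inverse function of f (g is continuous and strictly increasing with g(0) = 0, g(1) = 1), and let μ_g be the Borel probability measure on [0, 1] whose cumulative distribution function is g. Then μ_f is singular with respect to Lebesgue measure if and only if μ_g is singular with respect to Lebesgue measure. -/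
open MeasureTheory Filter Set Matrix

/-- A probability measure on `[0, 1]` is the pushforward of Lebesgue measure under the inverse of its
cumulative distribution function. -/
lemma eq_map_restrict_of_cdf_inverse {f g : ℝ → ℝ}
    (hgc : ContinuousOn g (Icc 0 1)) (hgm : StrictMonoOn g (Icc 0 1))
    (hf : MapsTo f (Icc 0 1) (Icc 0 1)) (hg : MapsTo g (Icc 0 1) (Icc 0 1))
    (hf0 : f 0 = 0) (hf1 : f 1 = 1)
    (hgf : ∀ x ∈ Icc (0 : ℝ) 1, g (f x) = x)
    (μ : Measure ℝ) [IsProbabilityMeasure μ]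
    (hμ : ∀ x ∈ Icc (0 : ℝ) 1, μ (Iic x) = ENNReal.ofReal (f x)) :
    μ = (volume.restrict (Icc (0 : ℝ) 1)).map g := by
  have hm : AEMeasurable g (volume.restrict (Icc (0 : ℝ) 1)) := hgc.aemeasurable measurableSet_Icc
  refine Measure.ext_of_Iic _ _ fun x => ?_
  rw [Measure.map_apply_of_aemeasurable hm measurableSet_Iic,
    Measure.restrict_apply' measurableSet_Icc]
  rcases lt_or_ge x 0 with hx | hx
  · have hempty : g ⁻¹' Iic x ∩ Icc 0 1 = ∅ := by
      ext y
      simp only [mem_inter_iff, mem_preimage, mem_Iic, mem_empty_iff_false, iff_false, not_and]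
      intro h hy
      linarith [(hg hy).1]
    rw [hempty, measure_empty]
    refine measure_mono_null (Iic_subset_Iic.2 hx.le) ?_
    rw [hμ 0 (by simp), hf0, ENNReal.ofReal_zero]
  rcases le_or_gt x 1 with hx1 | hx1
  · have hIcc : g ⁻¹' Iic x ∩ Icc 0 1 = Icc 0 (f x) := by
      ext y
      have hfx := hf ⟨hx, hx1⟩
      constructor
      · rintro ⟨h, hy⟩
        refine ⟨hy.1, (hgm.le_iff_le hy hfx).1 ?_⟩
        rwa [hgf x ⟨hx, hx1⟩]
      · rintro ⟨h0, hy⟩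
        have hyI : y ∈ Icc (0 : ℝ) 1 := ⟨h0, hy.trans hfx.2⟩
        refine ⟨?_, hyI⟩
        have := (hgm.le_iff_le hyI hfx).2 hy
        rwa [hgf x ⟨hx, hx1⟩] at this
    rw [hIcc, hμ x ⟨hx, hx1⟩, Real.volume_Icc, sub_zero]
  · have hIcc : g ⁻¹' Iic x ∩ Icc 0 1 = Icc 0 1 :=
      inter_eq_right.2 fun y hy => (hg hy).2.trans hx1.le
    rw [hIcc, Real.volume_Icc, sub_zero, ENNReal.ofReal_one]
    refine le_antisymm prob_le_one ?_
    calc (1 : ENNReal) = μ (Iic 1) := by rw [hμ 1 (by simp), hf1, ENNReal.ofReal_one]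
      _ ≤ μ (Iic x) := measure_mono (Iic_subset_Iic.2 hx1.le)

/-- If `f` and `g` are inverse to each other on `s`, singularity of the image of Lebesgue measure
on `s` under `g` implies singularity of its image under `f`. -/
lemma mutuallySingular_map_of_leftInvOn {f g : ℝ → ℝ} {s : Set ℝ} (hs : MeasurableSet s)
    (hfm : AEMeasurable f (volume.restrict s)) (hgm : AEMeasurable g (volume.restrict s))
    (hf : MapsTo f s s) (hgf : LeftInvOn g f s)
    (h : (volume.restrict s).map g ⟂ₘ (volume : Measure ℝ)) :
    (volume.restrict s).map f ⟂ₘ (volume : Measure ℝ) := by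
  obtain ⟨N, hN, hN0, hNc⟩ := h
  rw [Measure.map_apply_of_aemeasurable hgm hN, Measure.restrict_apply' hs] at hN0
  set T := toMeasurable volume (g ⁻¹' N ∩ s)
  have hT : MeasurableSet T := measurableSet_toMeasurable _ _
  refine ⟨Tᶜ, hT.compl, ?_, ?_⟩
  · rw [Measure.map_apply_of_aemeasurable hfm hT.compl, Measure.restrict_apply' hs]
    refine measure_mono_null ?_ hNc
    rintro x ⟨hxT, hx⟩ hxN
    refine hxT (subset_toMeasurable _ _ ⟨?_, hf hx⟩)
    rwa [mem_preimage, hgf hx]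
  · rw [compl_compl, measure_toMeasurable, hN0]

theorem stmt18
    (a0 b0 c0 d0 a1 b1 c1 d1 : ℝ)
    (hb0 : b0 = 0)
    (hA1a : 0 < (a0 + b0) / (c0 + d0))
    (hA1b : (a0 + b0) / (c0 + d0) = b1 / d1)
    (hA1c : b1 / d1 < (a1 + b1) / (c1 + d1))
    (hA1d : (a1 + b1) / (c1 + d1) = 1)
    (hA20 : 0 < a0 * d0 - b0 * c0)
    (hA21 : 0 < a1 * d1 - b1 * c1)
    (hA30 : Real.sqrt (a0 * d0 - b0 * c0) < min d0 (c0 + d0))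
    (hA31 : Real.sqrt (a1 * d1 - b1 * c1) < min d1 (c1 + d1))
    (f : ℝ → ℝ)
    (hfc : ContinuousOn f (Set.Icc 0 1))
    (hfm : StrictMonoOn f (Set.Icc 0 1))
    (hf0 : f 0 = 0) (hf1 : f 1 = 1)
    (hdR0 : ∀ x ∈ Set.Icc (0 : ℝ) (1 / 2), f x = Phi a0 b0 c0 d0 (f (2 * x)))
    (hdR1 : ∀ x ∈ Set.Icc (1 / 2 : ℝ) 1, f x = Phi a1 b1 c1 d1 (f (2 * x - 1)))
    (μf : Measure ℝ) [IsProbabilityMeasure μf]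
    (hμf : ∀ x ∈ Set.Icc (0 : ℝ) 1, μf (Set.Iic x) = ENNReal.ofReal (f x))
    (g : ℝ → ℝ)
    (hgc : ContinuousOn g (Set.Icc 0 1))
    (hgm : StrictMonoOn g (Set.Icc 0 1))
    (hg0 : g 0 = 0) (hg1 : g 1 = 1)
    (hgf : ∀ x ∈ Set.Icc (0 : ℝ) 1, g (f x) = x)
    (hfg : ∀ y ∈ Set.Icc (0 : ℝ) 1, f (g y) = y)
    (μg : Measure ℝ) [IsProbabilityMeasure μg]
    (hμg : ∀ x ∈ Set.Icc (0 : ℝ) 1, μg (Set.Iic x) = ENNReal.ofReal (g x)) :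
    μf ⟂ₘ (volume : Measure ℝ) ↔ μg ⟂ₘ (volume : Measure ℝ) := by
  have hf : MapsTo f (Icc 0 1) (Icc 0 1) := by
    simpa [hf0, hf1] using hfm.monotoneOn.mapsTo_Icc
  have hg : MapsTo g (Icc 0 1) (Icc 0 1) := by
    simpa [hg0, hg1] using hgm.monotoneOn.mapsTo_Icc
  rw [eq_map_restrict_of_cdf_inverse hgc hgm hf hg hf0 hf1 hgf μf hμf,
    eq_map_restrict_of_cdf_inverse hfc hfm hg hf hg0 hg1 hfg μg hμg]
  have hfae := hfc.aemeasurable (μ := volume) measurableSet_Icc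
  have hgae := hgc.aemeasurable (μ := volume) measurableSet_Icc
  exact ⟨mutuallySingular_map_of_leftInvOn measurableSet_Icc hfae hgae hf hgf,
    mutuallySingular_map_of_leftInvOn measurableSet_Icc hgae hfae hg hfg⟩
end

section
/- Let ν be the unique Borel probability measure on [0, 1] satisfying ν(B) = (ν(F_0^{−1}(B)) + ν(F_1^{−1}(B)))/2 for every Borel set B ⊆ [0, 1]. Then: (1) ν is absolutely continuous with respect to Lebesgue measure if and only if conditions (i) and (ii) both hold; (2) ν is singular with respect to Lebesgue measure if and only if condition (i) or condition (ii) fails. -/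
open MeasureTheory Filter Set Matrix

/-- A self-map of `[0, 1]` whose difference quotients factor as `u x * u y` with `0 < u ≤ r`.
Orientation preserving projective maps have this property, and it is stable under composition. -/
def FactorsOn (r : ℝ) (f : ℝ → ℝ) : Prop :=
  MapsTo f (Icc 0 1) (Icc 0 1) ∧ ∃ u : ℝ → ℝ, (∀ x ∈ Icc (0 : ℝ) 1, 0 < u x ∧ u x ≤ r) ∧
    ∀ x ∈ Icc (0 : ℝ) 1, ∀ y ∈ Icc (0 : ℝ) 1, f x - f y = u x * u y * (x - y)

namespace FactorsOn

variable {r s : ℝ} {f g : ℝ → ℝ}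

theorem mono (hf : FactorsOn r f) (h : r ≤ s) : FactorsOn s f := by
  obtain ⟨hm, u, hu, hfu⟩ := hf
  exact ⟨hm, u, fun x hx => ⟨(hu x hx).1, (hu x hx).2.trans h⟩, hfu⟩

protected theorem id : FactorsOn 1 fun x => x :=
  ⟨mapsTo_id _, fun _ => 1, fun _ _ => by norm_num, fun _ _ _ _ => by ring⟩

theorem comp (hf : FactorsOn r f) (hg : FactorsOn s g) : FactorsOn (r * s) fun x => f (g x) := by
  obtain ⟨hfm, u, hu, hfu⟩ := hf
  obtain ⟨hgm, v, hv, hgv⟩ := hg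
  refine ⟨fun x hx => hfm (hgm hx), fun x => u (g x) * v x, fun x hx => ?_, fun x hx y hy => ?_⟩
  · have h1 := hu _ (hgm hx)
    have h2 := hv _ hx
    exact ⟨mul_pos h1.1 h2.1, mul_le_mul h1.2 h2.2 h2.1.le (h1.1.le.trans h1.2)⟩
  · rw [hfu _ (hgm hx) _ (hgm hy), hgv _ hx _ hy]
    ring

theorem strictMonoOn (hf : FactorsOn r f) : StrictMonoOn f (Icc 0 1) := by
  obtain ⟨-, u, hu, hfu⟩ := hf
  intro x hx y hy hxy
  have h := hfu y hy x hx
  have := mul_pos (mul_pos (hu y hy).1 (hu x hx).1) (sub_pos.2 hxy)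
  linarith

theorem abs_sub_le (hf : FactorsOn r f) {x y : ℝ} (hx : x ∈ Icc (0 : ℝ) 1)
    (hy : y ∈ Icc (0 : ℝ) 1) : |f x - f y| ≤ r * r * |x - y| := by
  obtain ⟨-, u, hu, hfu⟩ := hf
  have h1 := hu x hx
  have h2 := hu y hy
  rw [hfu x hx y hy, abs_mul, abs_of_pos (mul_pos h1.1 h2.1)]
  gcongr
  exacts [h2.1.le, h1.1.le.trans h1.2, h1.2, h2.2]

theorem continuousOn (hf : FactorsOn r f) : ContinuousOn f (Icc 0 1) :=
  (LipschitzOnWith.of_dist_le_mul (K := ⟨r * r, mul_self_nonneg r⟩) fun _ hx _ hy =>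
    hf.abs_sub_le hx hy).continuousOn

theorem crossRatio (hf : FactorsOn r f) {x y : ℝ} (hx : x ∈ Icc (0 : ℝ) 1)
    (hy : y ∈ Icc (0 : ℝ) 1) :
    (f y - f 0) * (1 - y) * x * (f 1 - f x) = (f x - f 0) * (1 - x) * y * (f 1 - f y) := by
  obtain ⟨-, u, hu, hfu⟩ := hf
  have h0 : (0 : ℝ) ∈ Icc (0 : ℝ) 1 := by simp
  have h1 : (1 : ℝ) ∈ Icc (0 : ℝ) 1 := by simp
  rw [hfu y hy 0 h0, hfu 1 h1 x hx, hfu x hx 0 h0, hfu 1 h1 y hy]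
  ring

end FactorsOn

/-- Two uniformly contracting branches whose images tile `[0, 1]`. -/
structure TilingPair (r : ℝ) (F₀ F₁ : ℝ → ℝ) : Prop where
  nonneg : 0 ≤ r
  lt_one : r < 1
  left : FactorsOn r F₀
  right : FactorsOn r F₁
  left_zero : F₀ 0 = 0
  left_one : F₀ 1 = F₁ 0
  right_one : F₁ 1 = 1

/-- `G` conjugates the pair `F₀, F₁` to the dyadic pair `x / 2, (1 + x) / 2`. -/
def Linearizes (F₀ F₁ G : ℝ → ℝ) : Prop :=
  ∀ x ∈ Icc (0 : ℝ) 1, G (F₀ x) = G x / 2 ∧ G (F₁ x) = (1 + G x) / 2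

section TilingPair

variable {r : ℝ} {F₀ F₁ G : ℝ → ℝ}

theorem TilingPair.exists_preimage (h : TilingPair r F₀ F₁) {x : ℝ} (hx : x ∈ Icc (0 : ℝ) 1) :
    ∃ y ∈ Icc (0 : ℝ) 1, F₀ y = x ∨ F₁ y = x := by
  rcases le_total x (F₁ 0) with hxt | hxt
  · obtain ⟨y, hy, rfl⟩ := intermediate_value_Icc zero_le_one h.left.continuousOn
      (show x ∈ Icc (F₀ 0) (F₀ 1) by rw [h.left_zero, h.left_one]; exact ⟨hx.1, hxt⟩)
    exact ⟨y, hy, Or.inl rfl⟩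
  · obtain ⟨y, hy, rfl⟩ := intermediate_value_Icc zero_le_one h.right.continuousOn
      (show x ∈ Icc (F₁ 0) (F₁ 1) by rw [h.right_one]; exact ⟨hxt, hx.2⟩)
    exact ⟨y, hy, Or.inr rfl⟩

theorem TilingPair.exists_cylinder (h : TilingPair r F₀ F₁) (hG : Linearizes F₀ F₁ G) (n : ℕ) :
    ∀ x ∈ Icc (0 : ℝ) 1, ∃ f : ℝ → ℝ, FactorsOn (r ^ n) f ∧ (∃ y ∈ Icc (0 : ℝ) 1, f y = x) ∧
      ∃ c : ℝ, ∀ y ∈ Icc (0 : ℝ) 1, G (f y) = c + G y / 2 ^ n := by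
  induction n with
  | zero =>
    intro x hx
    exact ⟨fun x => x, by simpa using FactorsOn.id, ⟨x, hx, rfl⟩, 0, fun y _ => by simp⟩
  | succ n ih =>
    intro x hx
    obtain ⟨z, hz, hzx⟩ := h.exists_preimage hx
    obtain ⟨f, hf, ⟨y, hy, rfl⟩, c, hc⟩ := ih z hz
    rcases hzx with rfl | rfl
    · refine ⟨fun x => F₀ (f x), by simpa [pow_succ'] using h.left.comp hf, ⟨y, hy, rfl⟩,
        c / 2, fun x hx => ?_⟩
      rw [(hG _ (hf.1 hx)).1, hc x hx]
      ring
    · refine ⟨fun x => F₁ (f x), by simpa [pow_succ'] using h.right.comp hf, ⟨y, hy, rfl⟩,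
        (1 + c) / 2, fun x hx => ?_⟩
      rw [(hG _ (hf.1 hx)).2, hc x hx]
      ring

theorem TilingPair.eqOn_of_linearizes (h : TilingPair r F₀ F₁) {H : ℝ → ℝ}
    (hG : Linearizes F₀ F₁ G) (hH : Linearizes F₀ F₁ H)
    (hG01 : MapsTo G (Icc 0 1) (Icc 0 1)) (hH01 : MapsTo H (Icc 0 1) (Icc 0 1)) :
    EqOn G H (Icc 0 1) := by
  have key : ∀ n : ℕ, ∀ x ∈ Icc (0 : ℝ) 1, |G x - H x| ≤ (1 / 2) ^ n := by
    intro n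
    induction n with
    | zero =>
      intro x hx
      have h1 := hG01 hx
      have h2 := hH01 hx
      rw [abs_le]
      constructor <;> linarith [h1.1, h1.2, h2.1, h2.2, pow_zero (1 / 2 : ℝ)]
    | succ n ih =>
      intro x hx
      obtain ⟨y, hy, hyx⟩ := h.exists_preimage hx
      have h1 : G x - H x = 1 / 2 * (G y - H y) := by
        rcases hyx with rfl | rfl
        · rw [(hG y hy).1, (hH y hy).1]; ring
        · rw [(hG y hy).2, (hH y hy).2]; ring
      rw [h1, abs_mul, pow_succ', abs_of_pos (by norm_num : (0 : ℝ) < 1 / 2)]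
      exact mul_le_mul_of_nonneg_left (ih y hy) (by norm_num)
  intro x hx
  have hlim : Tendsto (fun n : ℕ => ((1 : ℝ) / 2) ^ n) atTop (nhds 0) :=
    tendsto_pow_atTop_nhds_zero_of_lt_one (by norm_num) (by norm_num)
  have := ge_of_tendsto' hlim fun n => key n x hx
  exact sub_eq_zero.1 (abs_nonpos_iff.1 this)

/-- A linearizing map with a nonzero derivative at a single point preserves cross ratios. -/
theorem TilingPair.crossRatio_of_hasDerivAt (h : TilingPair r F₀ F₁) (hG : Linearizes F₀ F₁ G)
    (hG0 : G 0 = 0) (hG1 : G 1 = 1) {x₀ L : ℝ} (hx₀ : x₀ ∈ Icc (0 : ℝ) 1) (hL : L ≠ 0)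
    (hd : HasDerivAt G L x₀) {x y : ℝ} (hx : x ∈ Icc (0 : ℝ) 1) (hy : y ∈ Icc (0 : ℝ) 1) :
    G y * (1 - y) * x * (1 - G x) = G x * (1 - x) * y * (1 - G y) := by
  choose f hf hfx c hc using fun n => h.exists_cylinder hG n x₀ hx₀
  have h0 : (0 : ℝ) ∈ Icc (0 : ℝ) 1 := by simp
  have h1 : (1 : ℝ) ∈ Icc (0 : ℝ) 1 := by simp
  have hpos : ∀ n, 0 < f n 1 - f n 0 := fun n =>
    sub_pos.2 ((hf n).strictMonoOn h0 h1 zero_lt_one)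
  have hclose : ∀ z ∈ Icc (0 : ℝ) 1, Tendsto (fun n => f n z) atTop (nhds x₀) := by
    intro z hz
    have hr2 : Tendsto (fun n : ℕ => (r * r) ^ n) atTop (nhds 0) :=
      tendsto_pow_atTop_nhds_zero_of_lt_one (mul_self_nonneg r)
        (by nlinarith [h.nonneg, h.lt_one])
    rw [tendsto_iff_dist_tendsto_zero]
    refine squeeze_zero (fun _ => dist_nonneg) (fun n => ?_) hr2
    obtain ⟨w, hw, hwx⟩ := hfx n
    have h2 := (hf n).abs_sub_le hz hw
    have h3 : |z - w| ≤ 1 := by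
      rw [abs_le]; constructor <;> linarith [hz.1, hz.2, hw.1, hw.2]
    rw [Real.dist_eq, ← hwx, mul_pow]
    exact h2.trans (mul_le_of_le_one_right (mul_self_nonneg _) h3)
  have herr : ∀ z ∈ Icc (0 : ℝ) 1,
      Tendsto (fun n => (G (f n z) - G x₀ - (f n z - x₀) * L) / (f n 1 - f n 0))
        atTop (nhds 0) := by
    intro z hz
    have h2 := hd.isLittleO.comp_tendsto (hclose z hz)
    have h3 : (fun n => f n z - x₀) =O[atTop] fun n => f n 1 - f n 0 := by
      refine Asymptotics.IsBigO.of_bound 1 (Eventually.of_forall fun n => ?_)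
      obtain ⟨w, hw, hwx⟩ := hfx n
      have hm := (hf n).strictMonoOn.monotoneOn
      rw [Real.norm_eq_abs, Real.norm_eq_abs, abs_of_pos (hpos n), ← hwx, one_mul, abs_le]
      constructor <;> linarith [hm h0 hz hz.1, hm hz h1 hz.2, hm h0 hw hw.1, hm hw h1 hw.2]
    have h4 := (h2.trans_isBigO h3).tendsto_div_nhds_zero
    simpa [Function.comp_def] using h4
  have hratio : ∀ z ∈ Icc (0 : ℝ) 1,
      Tendsto (fun n => G z / 2 ^ n / (f n 1 - f n 0)
        - L * ((f n z - f n 0) / (f n 1 - f n 0))) atTop (nhds 0) := by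
    intro z hz
    have h2 := (herr z hz).sub (herr 0 h0)
    rw [sub_zero] at h2
    refine h2.congr fun n => ?_
    rw [hc n z hz, hc n 0 h0, hG0]
    ring
  have hscale : Tendsto (fun n => 1 / 2 ^ n / (f n 1 - f n 0)) atTop (nhds L) := by
    have h2 := (hratio 1 h1).add_const L
    rw [zero_add] at h2
    refine h2.congr fun n => ?_
    rw [hG1, div_self (hpos n).ne']
    ring
  have hlim : ∀ z ∈ Icc (0 : ℝ) 1,
      Tendsto (fun n => (f n z - f n 0) / (f n 1 - f n 0)) atTop (nhds (G z)) := by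
    intro z hz
    have h2 := ((hscale.const_mul (G z)).sub (hratio z hz)).div_const L
    rw [sub_zero, mul_div_cancel_right₀ _ hL] at h2
    refine h2.congr fun n => ?_
    field_simp
    ring
  have hone : ∀ z n, 1 - (f n z - f n 0) / (f n 1 - f n 0)
      = (f n 1 - f n z) / (f n 1 - f n 0) := by
    intro z n
    have := (hpos n).ne'
    field_simp
    ring
  have hl := (((hlim y hy).mul_const (1 - y)).mul_const x).mul ((hlim x hx).const_sub 1)
  have hr := (((hlim x hx).mul_const (1 - x)).mul_const y).mul ((hlim y hy).const_sub 1)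
  refine tendsto_nhds_unique hl (hr.congr fun n => ?_)
  rw [hone, hone]
  have := (hf n).crossRatio hx hy
  have h2 := (hpos n).ne'
  field_simp
  linarith

end TilingPair

theorem phi_sub_phi {a b c d x y : ℝ} (hdet : 0 ≤ a * d - b * c) (hx : c * x + d ≠ 0)
    (hy : c * y + d ≠ 0) :
    Phi a b c d x - Phi a b c d y =
      √(a * d - b * c) / (c * x + d) * (√(a * d - b * c) / (c * y + d)) * (x - y) := by
  rw [Phi, Phi, div_sub_div _ _ hx hy, div_mul_div_comm, Real.mul_self_sqrt hdet,
    div_mul_eq_mul_div]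
  congr 1
  ring

theorem denom_ge {c d x m : ℝ} (hd : m ≤ d) (hcd : m ≤ c + d) (hx : x ∈ Icc (0 : ℝ) 1) :
    m ≤ c * x + d := by
  nlinarith [hx.1, hx.2, mul_nonneg hx.1 (sub_nonneg.2 hcd),
    mul_nonneg (sub_nonneg.2 hx.2) (sub_nonneg.2 hd)]

theorem factorsOn_phi {a b c d : ℝ} (hdet : 0 < a * d - b * c)
    (hA3 : √(a * d - b * c) < min d (c + d)) (h0 : 0 ≤ Phi a b c d 0)
    (h1 : Phi a b c d 1 ≤ 1) :
    ∃ r, 0 ≤ r ∧ r < 1 ∧ FactorsOn r (Phi a b c d) := by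
  have hs : 0 < √(a * d - b * c) := Real.sqrt_pos.2 hdet
  have hm : 0 < min d (c + d) := hs.trans hA3
  have hden : ∀ x ∈ Icc (0 : ℝ) 1, min d (c + d) ≤ c * x + d := fun x hx =>
    denom_ge (min_le_left _ _) (min_le_right _ _) hx
  have hpos : ∀ x ∈ Icc (0 : ℝ) 1, 0 < √(a * d - b * c) / (c * x + d) := fun x hx =>
    div_pos hs (hm.trans_le (hden x hx))
  have hsub : ∀ x ∈ Icc (0 : ℝ) 1, ∀ y ∈ Icc (0 : ℝ) 1, Phi a b c d x - Phi a b c d y =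
      √(a * d - b * c) / (c * x + d) * (√(a * d - b * c) / (c * y + d)) * (x - y) :=
    fun x hx y hy => phi_sub_phi hdet.le (hm.trans_le (hden x hx)).ne'
      (hm.trans_le (hden y hy)).ne'
  have hmono : MonotoneOn (Phi a b c d) (Icc 0 1) := by
    intro x hx y hy hxy
    have := mul_nonneg (mul_pos (hpos y hy) (hpos x hx)).le (sub_nonneg.2 hxy)
    rw [← hsub y hy x hx] at this
    linarith
  refine ⟨√(a * d - b * c) / min d (c + d), (div_pos hs hm).le, (div_lt_one hm).2 hA3, ?_,
    fun x => √(a * d - b * c) / (c * x + d), fun x hx => ⟨hpos x hx, ?_⟩, hsub⟩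
  · intro x hx
    exact ⟨h0.trans (hmono (by simp) hx hx.1), (hmono hx (by simp) hx.2).trans h1⟩
  · exact div_le_div_of_nonneg_left hs.le hm (hden x hx)

section InvariantMeasure

variable {r : ℝ} {F₀ F₁ : ℝ → ℝ} {ν : Measure ℝ} [IsProbabilityMeasure ν]

theorem measureReal_inter_Icc (hν1 : ν (Icc 0 1) = 1) (s : Set ℝ) :
    ν.real (s ∩ Icc 0 1) = ν.real s := by
  have h : ν (Icc (0 : ℝ) 1)ᶜ = 0 := (prob_compl_eq_zero_iff measurableSet_Icc).2 hν1
  rw [measureReal_def, measureReal_def, measure_inter_conull h]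

theorem cdf_of_one_le (hν1 : ν (Icc 0 1) = 1) {x : ℝ} (hx : 1 ≤ x) :
    ProbabilityTheory.cdf ν x = 1 := by
  rw [ProbabilityTheory.cdf_eq_real, ← measureReal_inter_Icc hν1,
    inter_eq_self_of_subset_right fun y hy => hy.2.trans hx, measureReal_def, hν1]
  simp

theorem cdf_of_neg (hν1 : ν (Icc 0 1) = 1) {x : ℝ} (hx : x < 0) :
    ProbabilityTheory.cdf ν x = 0 := by
  rw [ProbabilityTheory.cdf_eq_real, ← measureReal_inter_Icc hν1,
    (disjoint_left.2 fun y hy hy' => absurd (hy'.1.trans hy) (not_le.2 hx)).inter_eq]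
  simp

variable (hν : ∀ B : Set ℝ, MeasurableSet B →
  ν B = (ν (F₀ ⁻¹' B ∩ Icc 0 1) + ν (F₁ ⁻¹' B ∩ Icc 0 1)) / 2)

include hν

theorem measureReal_eq_of_invariant {B : Set ℝ} (hB : MeasurableSet B) :
    ν.real B = (ν.real (F₀ ⁻¹' B ∩ Icc 0 1) + ν.real (F₁ ⁻¹' B ∩ Icc 0 1)) / 2 := by
  rw [measureReal_def, hν B hB, ENNReal.toReal_div, ENNReal.toReal_add (by simp) (by simp)]
  rfl

theorem TilingPair.measureReal_zero (h : TilingPair r F₀ F₁) : ν.real {0} = 0 := by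
  have h0 : (0 : ℝ) ∈ Icc (0 : ℝ) 1 := by simp
  have h1 : (1 : ℝ) ∈ Icc (0 : ℝ) 1 := by simp
  have e0 : F₀ ⁻¹' {0} ∩ Icc 0 1 = {0} := by
    ext x
    simp only [mem_inter_iff, mem_preimage, mem_singleton_iff]
    constructor
    · rintro ⟨hx, hxI⟩
      exact h.left.strictMonoOn.injOn hxI h0 (hx.trans h.left_zero.symm)
    · rintro rfl
      exact ⟨h.left_zero, h0⟩
  have e1 : F₁ ⁻¹' {0} ∩ Icc 0 1 = ∅ := by
    refine eq_empty_of_forall_notMem ?_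
    rintro x ⟨hx, hxI⟩
    have h2 := h.left.strictMonoOn h0 h1 zero_lt_one
    have h3 := h.right.strictMonoOn.monotoneOn h0 hxI hxI.1
    rw [h.left_zero, h.left_one] at h2
    have : F₁ x = 0 := hx
    linarith
  have := measureReal_eq_of_invariant hν (measurableSet_singleton (0 : ℝ))
  rw [e0, e1, measureReal_empty] at this
  linarith

theorem TilingPair.cdf_zero (h : TilingPair r F₀ F₁) (hν1 : ν (Icc 0 1) = 1) :
    ProbabilityTheory.cdf ν 0 = 0 := by
  have e : Iic (0 : ℝ) ∩ Icc 0 1 = {0} := by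
    ext x
    simp only [mem_inter_iff, mem_Iic, mem_Icc, mem_singleton_iff]
    constructor
    · intro hx
      linarith
    · rintro rfl
      norm_num
  rw [ProbabilityTheory.cdf_eq_real, ← measureReal_inter_Icc hν1, e, h.measureReal_zero hν]

theorem TilingPair.linearizes_cdf (h : TilingPair r F₀ F₁) (hν1 : ν (Icc 0 1) = 1) :
    Linearizes F₀ F₁ (ProbabilityTheory.cdf ν) := by
  have h0 : (0 : ℝ) ∈ Icc (0 : ℝ) 1 := by simp
  have h1 : (1 : ℝ) ∈ Icc (0 : ℝ) 1 := by simp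
  have hpre : ∀ {f : ℝ → ℝ}, FactorsOn r f → ∀ x ∈ Icc (0 : ℝ) 1,
      ν.real (f ⁻¹' Iic (f x) ∩ Icc 0 1) = ν.real (Iic x) := by
    intro f hf x hx
    rw [← measureReal_inter_Icc hν1 (Iic x)]
    congr 1
    ext y
    simp only [mem_inter_iff, mem_preimage, mem_Iic]
    exact and_congr_left fun hy => hf.strictMonoOn.le_iff_le hy hx
  intro x hx
  simp only [ProbabilityTheory.cdf_eq_real]
  rw [measureReal_eq_of_invariant hν (measurableSet_Iic (a := F₀ x)),
    measureReal_eq_of_invariant hν (measurableSet_Iic (a := F₁ x)),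
    hpre h.left x hx, hpre h.right x hx]
  constructor
  · have e : ν.real (F₁ ⁻¹' Iic (F₀ x) ∩ Icc 0 1) = 0 := by
      refine le_antisymm ((measureReal_mono ?_).trans_eq (h.measureReal_zero hν))
        measureReal_nonneg
      rintro y ⟨hy, hyI⟩
      have h2 : F₁ y ≤ F₁ 0 :=
        (mem_Iic.1 hy).trans (h.left_one ▸ h.left.strictMonoOn.monotoneOn hx h1 hx.2)
      exact le_antisymm ((h.right.strictMonoOn.le_iff_le hyI h0).1 h2) hyI.1
    rw [e, add_zero]
  · have e : F₀ ⁻¹' Iic (F₁ x) ∩ Icc 0 1 = Icc 0 1 := by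
      refine inter_eq_self_of_subset_right fun y hy => ?_
      have h2 := h.left.strictMonoOn.monotoneOn hy h1 hy.2
      rw [h.left_one] at h2
      exact h2.trans (h.right.strictMonoOn.monotoneOn h0 hx hx.1)
    rw [e, measureReal_def, hν1, ENNReal.toReal_one]

theorem TilingPair.crossRatio_of_not_mutuallySingular (h : TilingPair r F₀ F₁)
    (hν1 : ν (Icc 0 1) = 1) (hs : ¬ ν ⟂ₘ volume) {x y : ℝ} (hx : x ∈ Icc (0 : ℝ) 1)
    (hy : y ∈ Icc (0 : ℝ) 1) :
    ProbabilityTheory.cdf ν y * (1 - y) * x * (1 - ProbabilityTheory.cdf ν x) =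
      ProbabilityTheory.cdf ν x * (1 - x) * y * (1 - ProbabilityTheory.cdf ν y) := by
  obtain ⟨x₀, L, hL, hd⟩ : ∃ x₀ L : ℝ, L ≠ 0 ∧
      HasDerivAt (ProbabilityTheory.cdf ν) L x₀ := by
    by_contra! hcon
    refine hs ((Measure.rnDeriv_eq_zero ν volume).1 ?_)
    have hae := (ProbabilityTheory.cdf ν).ae_hasDerivAt
    rw [ProbabilityTheory.measure_cdf] at hae
    filter_upwards [hae, Measure.rnDeriv_lt_top ν volume] with z hz hfin
    by_contra hne
    exact hcon z _ (ENNReal.toReal_ne_zero.2 ⟨hne, hfin.ne⟩) hz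
  have hx₀ : x₀ ∈ Icc (0 : ℝ) 1 := by
    by_contra hout
    refine hL ?_
    have hconst : ∀ c : ℝ, ProbabilityTheory.cdf ν =ᶠ[nhds x₀] (fun _ => c) → L = 0 :=
      fun c hc => hd.unique ((hasDerivAt_const x₀ c).congr_of_eventuallyEq hc)
    rcases lt_or_ge x₀ 0 with hlt | hge
    · refine hconst 0 ?_
      filter_upwards [Iio_mem_nhds hlt] with z hz using cdf_of_neg hν1 hz
    · refine hconst 1 ?_
      have hgt : 1 < x₀ := lt_of_not_ge fun hle => hout ⟨hge, hle⟩
      filter_upwards [Ioi_mem_nhds hgt] with z hz using cdf_of_one_le hν1 (le_of_lt hz)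
  exact h.crossRatio_of_hasDerivAt (h.linearizes_cdf hν hν1) (h.cdf_zero hν hν1)
    (cdf_of_one_le hν1 le_rfl) hx₀ hL hd hx hy

end InvariantMeasure

theorem absolutelyContinuous_of_cdf_lipschitz {ν : Measure ℝ} [IsProbabilityMeasure ν] {K : NNReal}
    (hK : ∀ x y, x ≤ y →
      ProbabilityTheory.cdf ν y - ProbabilityTheory.cdf ν x ≤ K * (y - x)) :
    ν ≪ volume := by
  let S : StieltjesFunction ℝ :=
    { toFun := fun x => K * x - ProbabilityTheory.cdf ν x
      mono' := fun x y hxy => by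
        have := hK x y hxy
        dsimp only
        linarith
      right_continuous' := fun x => (by fun_prop : Continuous fun x : ℝ => (K : ℝ) * x)
        |>.continuousWithinAt.sub ((ProbabilityTheory.cdf ν).right_continuous x) }
  have hS : ProbabilityTheory.cdf ν + S = K • StieltjesFunction.id := by
    ext x
    change ProbabilityTheory.cdf ν x + (K * x - ProbabilityTheory.cdf ν x) = K * x
    ring
  have hm : ν + S.measure = K • (volume : Measure ℝ) := by
    have hadd := StieltjesFunction.measure_add (ProbabilityTheory.cdf ν) S
    rw [hS, ProbabilityTheory.measure_cdf] at hadd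
    rw [← hadd, Real.volume_eq_stieltjes_id]
    exact StieltjesFunction.measure_smul K StieltjesFunction.id
  have hle : ν ≤ K • (volume : Measure ℝ) := hm ▸ Measure.le_add_right le_rfl
  exact hle.absolutelyContinuous.trans (Measure.smul_absolutelyContinuous (c := K))

/-- The projective map of `[0, 1]` fixing the endpoints and sending `t` to `1 / 2`. -/
noncomputable def halving (t x : ℝ) : ℝ := (1 - t) * x / (t * (1 - x) + (1 - t) * x)

section Halving

variable {t : ℝ}

theorem halving_denom_ge {x : ℝ} (hx : x ∈ Icc (0 : ℝ) 1) :
    min t (1 - t) ≤ t * (1 - x) + (1 - t) * x := by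
  nlinarith [mul_nonneg hx.1 (sub_nonneg.2 (min_le_right t (1 - t))),
    mul_nonneg (sub_nonneg.2 hx.2) (sub_nonneg.2 (min_le_left t (1 - t)))]

theorem halving_denom_pos (h0 : 0 < t) (h1 : t < 1) {x : ℝ} (hx : x ∈ Icc (0 : ℝ) 1) :
    0 < t * (1 - x) + (1 - t) * x :=
  (lt_min h0 (sub_pos.2 h1)).trans_le (halving_denom_ge hx)

theorem mapsTo_halving (h0 : 0 < t) (h1 : t < 1) : MapsTo (halving t) (Icc 0 1) (Icc 0 1) := by
  intro x hx
  have hD := halving_denom_pos h0 h1 hx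
  have h2 : 0 ≤ (1 - t) * x := mul_nonneg (sub_nonneg.2 h1.le) hx.1
  have h3 : 0 ≤ t * (1 - x) := mul_nonneg h0.le (sub_nonneg.2 hx.2)
  exact ⟨div_nonneg h2 hD.le, (div_le_one hD).2 (by linarith)⟩

theorem halving_sub_le (h0 : 0 < t) (h1 : t < 1) {x y : ℝ} (hx : x ∈ Icc (0 : ℝ) 1)
    (hy : y ∈ Icc (0 : ℝ) 1) (hxy : x ≤ y) :
    halving t y - halving t x ≤ 1 / (min t (1 - t) * min t (1 - t)) * (y - x) := by
  have hm : 0 < min t (1 - t) := lt_min h0 (sub_pos.2 h1)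
  have hDx := halving_denom_pos h0 h1 hx
  have hDy := halving_denom_pos h0 h1 hy
  have e : halving t y - halving t x = t * (1 - t) /
      ((t * (1 - y) + (1 - t) * y) * (t * (1 - x) + (1 - t) * x)) * (y - x) := by
    rw [halving, halving]
    field_simp
    ring
  rw [e]
  refine mul_le_mul_of_nonneg_right ?_ (sub_nonneg.2 hxy)
  exact div_le_div₀ zero_le_one (by nlinarith) (mul_pos hm hm)
    (mul_le_mul (halving_denom_ge hy) (halving_denom_ge hx) hm.le hDy.le)

theorem absolutelyContinuous_of_cdf_eqOn_halving (h0 : 0 < t) (h1 : t < 1) {ν : Measure ℝ}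
    [IsProbabilityMeasure ν] (hν1 : ν (Icc 0 1) = 1)
    (hE : EqOn (ProbabilityTheory.cdf ν) (halving t) (Icc 0 1)) : ν ≪ volume := by
  have hm : 0 < min t (1 - t) := lt_min h0 (sub_pos.2 h1)
  have hE0 : ProbabilityTheory.cdf ν 0 = 0 := by
    rw [hE (by simp), halving]
    simp
  have hclamp : ∀ x, ProbabilityTheory.cdf ν x = halving t (max 0 (min x 1)) := by
    intro x
    rcases lt_or_ge x 0 with hx | hx
    · rw [cdf_of_neg hν1 hx, min_eq_left (by linarith), max_eq_left hx.le, halving]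
      simp
    rcases lt_or_ge x 1 with hx' | hx'
    · rw [min_eq_left hx'.le, max_eq_right hx, hE ⟨hx, hx'.le⟩]
    · rw [cdf_of_one_le hν1 hx', min_eq_right hx', max_eq_right zero_le_one, ← hE (by simp),
        cdf_of_one_le hν1 le_rfl]
  have hI : ∀ x : ℝ, max 0 (min x 1) ∈ Icc (0 : ℝ) 1 := fun x =>
    ⟨le_max_left _ _, max_le zero_le_one (min_le_right _ _)⟩
  refine absolutelyContinuous_of_cdf_lipschitz
    (K := ⟨1 / (min t (1 - t) * min t (1 - t)), by positivity⟩) fun x y hxy => ?_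
  rw [hclamp, hclamp]
  refine (halving_sub_le h0 h1 (hI x) (hI y)
    (max_le_max_left _ (min_le_min_right _ hxy))).trans ?_
  refine mul_le_mul_of_nonneg_left ?_ (by positivity)
  rcases le_total x 1 with hx | hx <;> rcases le_total y 1 with hy | hy <;>
    rcases le_total x 0 with hx' | hx' <;> rcases le_total y 0 with hy' | hy' <;>
    simp [*] <;> linarith

theorem halving_div {p q : ℝ} (hq : q ≠ 0) :
    halving t (p / q) = (1 - t) * p / (t * (q - p) + (1 - t) * p) := by
  have e : t * (1 - p / q) + (1 - t) * (p / q) = (t * (q - p) + (1 - t) * p) / q := by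
    field_simp
  rw [halving, e, ← mul_div_assoc, div_div_div_cancel_right₀ hq]

theorem linearizes_halving (h0 : 0 < t) (h1 : t < 1) {F₀ F₁ : ℝ → ℝ}
    (hF₀ : ∀ x ∈ Icc (0 : ℝ) 1, F₀ x = t * x / ((1 - 2 * t) * x + 2 * t))
    (hF₁ : ∀ x ∈ Icc (0 : ℝ) 1, F₁ x = ((2 - 3 * t) * x + t) / ((1 - 2 * t) * x + 1)) :
    Linearizes F₀ F₁ (halving t) := by
  intro x hx
  have hD := halving_denom_pos h0 h1 hx
  have hD₀ : 0 < (1 - 2 * t) * x + 2 * t := by nlinarith [hx.1, hx.2]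
  have hD₁ : 0 < (1 - 2 * t) * x + 1 := by nlinarith [hx.1, hx.2]
  have e₀ : t * ((1 - 2 * t) * x + 2 * t - t * x) + (1 - t) * (t * x) =
      2 * t * (t * (1 - x) + (1 - t) * x) := by ring
  have e₁ : t * ((1 - 2 * t) * x + 1 - ((2 - 3 * t) * x + t)) + (1 - t) * ((2 - 3 * t) * x + t) =
      2 * (1 - t) * (t * (1 - x) + (1 - t) * x) := by ring
  have e₂ : (2 - 3 * t) * x + t = t * (1 - x) + (1 - t) * x + (1 - t) * x := by ring
  rw [hF₀ x hx, hF₁ x hx, halving_div hD₀.ne', halving_div hD₁.ne', e₀, e₁, e₂, halving]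
  generalize t * (1 - x) + (1 - t) * x = D at hD
  have : 1 - t ≠ 0 := (sub_pos.2 h1).ne'
  constructor <;> field_simp

end Halving

theorem stmt19
    (a0 b0 c0 d0 a1 b1 c1 d1 : ℝ)
    (hb0 : b0 = 0)
    (hA1a : 0 < (a0 + b0) / (c0 + d0))
    (hA1b : (a0 + b0) / (c0 + d0) = b1 / d1)
    (hA1c : b1 / d1 < (a1 + b1) / (c1 + d1))
    (hA1d : (a1 + b1) / (c1 + d1) = 1)
    (hA20 : 0 < a0 * d0 - b0 * c0)
    (hA21 : 0 < a1 * d1 - b1 * c1)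
    (hA30 : Real.sqrt (a0 * d0 - b0 * c0) < min d0 (c0 + d0))
    (hA31 : Real.sqrt (a1 * d1 - b1 * c1) < min d1 (c1 + d1))
    (ν : Measure ℝ) [IsProbabilityMeasure ν] (hν1 : ν (Set.Icc 0 1) = 1)
    (hν : ∀ B : Set ℝ, MeasurableSet B →
      ν B = (ν (Phi a0 b0 c0 d0 ⁻¹' B ∩ Set.Icc 0 1) +
             ν (Phi a1 b1 c1 d1 ⁻¹' B ∩ Set.Icc 0 1)) / 2) :
    (ν ≪ (volume : Measure ℝ) ↔ ((c0 + d0 - 2 * a0) * (d0 - a0) = a0 * c0 ∧ (a1 - 2 * c1) * (d1 - 2 * b1) = b1 * c1)) ∧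
    (ν ⟂ₘ (volume : Measure ℝ) ↔ ((c0 + d0 - 2 * a0) * (d0 - a0) ≠ a0 * c0 ∨ (a1 - 2 * c1) * (d1 - 2 * b1) ≠ b1 * c1)) := by
  subst hb0
  have hd0 : 0 < d0 := (Real.sqrt_nonneg _).trans_lt (hA30.trans_le (min_le_left _ _))
  have hcd0 : 0 < c0 + d0 := (Real.sqrt_nonneg _).trans_lt (hA30.trans_le (min_le_right _ _))
  have hd1 : 0 < d1 := (Real.sqrt_nonneg _).trans_lt (hA31.trans_le (min_le_left _ _))
  have hcd1 : 0 < c1 + d1 := (Real.sqrt_nonneg _).trans_lt (hA31.trans_le (min_le_right _ _))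
  obtain ⟨t, ht⟩ : ∃ t, b1 / d1 = t := ⟨_, rfl⟩
  have ht0 : 0 < t := by rwa [← ht, ← hA1b]
  have ht1 : t < 1 := by rwa [← ht, ← hA1d]
  have hb1 : b1 = t * d1 := (div_eq_iff hd1.ne').1 ht
  have ha0 : a0 = t * (c0 + d0) := by
    rw [ht, add_zero] at hA1b
    exact (div_eq_iff hcd0.ne').1 hA1b
  have ha1 : a1 = c1 + d1 - t * d1 := by
    have := (div_eq_iff hcd1.ne').1 hA1d
    linarith
  have hi : (c0 + d0 - 2 * a0) * (d0 - a0) = a0 * c0 ↔ d0 = 2 * t * (c0 + d0) := by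
    have e : (c0 + d0 - 2 * a0) * (d0 - a0) - a0 * c0 =
        ((c0 + d0) * (1 - t)) * (d0 - 2 * t * (c0 + d0)) := by rw [ha0]; ring
    rw [← sub_eq_zero, e, mul_eq_zero, sub_eq_zero (a := d0)]
    exact or_iff_right (mul_pos hcd0 (sub_pos.2 ht1)).ne'
  have hii : (a1 - 2 * c1) * (d1 - 2 * b1) = b1 * c1 ↔ c1 = d1 * (1 - 2 * t) := by
    have e : (a1 - 2 * c1) * (d1 - 2 * b1) - b1 * c1 =
        (d1 * (1 - t)) * (d1 * (1 - 2 * t) - c1) := by rw [ha1, hb1]; ring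
    rw [← sub_eq_zero, e, mul_eq_zero, sub_eq_zero (a := d1 * (1 - 2 * t)), eq_comm (a := c1)]
    exact or_iff_right (mul_pos hd1 (sub_pos.2 ht1)).ne'
  have hF00 : Phi a0 0 c0 d0 0 = 0 := by simp [Phi]
  have hF01 : Phi a0 0 c0 d0 1 = t := by simpa [Phi, ht] using hA1b
  have hF10 : Phi a1 b1 c1 d1 0 = t := by simpa [Phi] using ht
  have hF11 : Phi a1 b1 c1 d1 1 = 1 := by simpa [Phi] using hA1d
  obtain ⟨r, hr⟩ : ∃ r, TilingPair r (Phi a0 0 c0 d0) (Phi a1 b1 c1 d1) := by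
    obtain ⟨r₀, h0, h1, h2⟩ := factorsOn_phi hA20 hA30 hF00.ge (hF01.trans_le ht1.le)
    obtain ⟨r₁, h3, h4, h5⟩ := factorsOn_phi hA21 hA31 (ht0.le.trans_eq hF10.symm) hF11.le
    exact ⟨max r₀ r₁, h0.trans (le_max_left _ _), max_lt h1 h4, h2.mono (le_max_left _ _),
      h5.mono (le_max_right _ _), hF00, hF01.trans hF10.symm, hF11⟩
  have hlin := hr.linearizes_cdf hν hν1
  have hac : d0 = 2 * t * (c0 + d0) → c1 = d1 * (1 - 2 * t) → ν ≪ volume := by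
    intro h0 h1
    refine absolutelyContinuous_of_cdf_eqOn_halving ht0 ht1 hν1
      (hr.eqOn_of_linearizes hlin (linearizes_halving ht0 ht1 (fun x hx => ?_) fun x hx => ?_)
        (fun x _ => ⟨ProbabilityTheory.cdf_nonneg ν x, ProbabilityTheory.cdf_le_one ν x⟩)
        (mapsTo_halving ht0 ht1))
    · have e : c0 * x + d0 = (c0 + d0) * ((1 - 2 * t) * x + 2 * t) := by
        linear_combination (1 - x) * h0
      rw [Phi, e, ha0, add_zero, mul_comm t, mul_assoc, mul_div_mul_left _ _ hcd0.ne']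
    · have e : c1 * x + d1 = d1 * ((1 - 2 * t) * x + 1) := by
        rw [h1]; ring
      have e' : a1 * x + b1 = d1 * ((2 - 3 * t) * x + t) := by
        rw [ha1, hb1, h1]; ring
      rw [Phi, e, e', mul_div_mul_left _ _ hd1.ne']
  have hsing : ¬ ν ⟂ₘ volume → d0 = 2 * t * (c0 + d0) ∧ c1 = d1 * (1 - 2 * t) := by
    intro hs
    have hI1 : (1 : ℝ) ∈ Icc (0 : ℝ) 1 := by simp
    have hIh : (1 / 2 : ℝ) ∈ Icc (0 : ℝ) 1 := by norm_num
    have hGt : ProbabilityTheory.cdf ν t = 1 / 2 := by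
      rw [← hF01, (hlin 1 hI1).1, cdf_of_one_le hν1 le_rfl]
    have hcr : ∀ y ∈ Icc (0 : ℝ) 1, ProbabilityTheory.cdf ν y * (1 - y) * t =
        (1 - t) * y * (1 - ProbabilityTheory.cdf ν y) := by
      intro y hy
      have := hr.crossRatio_of_not_mutuallySingular hν hν1 hs ⟨ht0.le, ht1.le⟩ hy
      rw [hGt] at this
      linarith
    have hGh : ProbabilityTheory.cdf ν (1 / 2) = 1 - t := by
      have := hcr _ hIh
      linarith
    have hz0 := hcr _ (hr.left.1 hIh)
    have hz1 := hcr _ (hr.right.1 hIh)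
    rw [(hlin _ hIh).1, hGh] at hz0
    rw [(hlin _ hIh).2, hGh] at hz1
    have hD0 : 0 < c0 * (1 / 2) + d0 := by linarith
    have hD1 : 0 < c1 * (1 / 2) + d1 := by linarith
    have e0 := div_mul_cancel₀ (a0 * (1 / 2) + 0) hD0.ne'
    have e1 := div_mul_cancel₀ (a1 * (1 / 2) + b1) hD1.ne'
    rw [← Phi] at e0 e1
    have hs1 : 1 - t ≠ 0 := (sub_pos.2 ht1).ne'
    constructor
    · have h2 : Phi a0 0 c0 d0 (1 / 2) * (1 + 2 * t) = t := by
        refine mul_left_cancel₀ hs1 ?_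
        linear_combination (-2) * hz0
      have h3 : t * (d0 - 2 * t * (c0 + d0)) = 0 := by
        rw [ha0] at e0 h2
        linear_combination (-2) * (c0 * (1 / 2) + d0) * h2 + 2 * (1 + 2 * t) * e0
      have := (mul_eq_zero.1 h3).resolve_left ht0.ne'
      linarith
    · have h2 : Phi a1 b1 c1 d1 (1 / 2) * (3 - 2 * t) = 2 - t := by
        refine mul_left_cancel₀ ht0.ne' ?_
        linear_combination (-2) * hz1
      have h3 : (1 - t) * (c1 - d1 * (1 - 2 * t)) = 0 := by
        rw [ha1, hb1] at e1 h2
        linear_combination 2 * (c1 * (1 / 2) + d1) * h2 - 2 * (3 - 2 * t) * e1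
      have := (mul_eq_zero.1 h3).resolve_left hs1
      linarith
  have hexcl : ν ≪ volume → ¬ ν ⟂ₘ volume := fun h h' =>
    IsProbabilityMeasure.ne_zero ν
      (Measure.eq_zero_of_absolutelyContinuous_of_mutuallySingular h h')
  rw [Ne, Ne, ← not_and_or, hi, hii]
  refine ⟨⟨fun h => hsing (hexcl h), fun h => hac h.1 h.2⟩,
    fun h hc => hexcl (hac hc.1 hc.2) h, fun h => ?_⟩
  by_contra hs
  exact h (hsing hs)
end
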